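/- There exists a constant C > 0 (depending only on the distribution of ξ) such that for all integers ℓ, m ≥ 0 and n ≥ 1 (with P(|𝒯| = n) > 0), E Y_{ℓ,m}(T_n) ≤ C n, where Y_{ℓ,m}(τ) := #{ordered pairs (v, w) of vertices of τ : d(v, v∧w) = ℓ and d(w, v∧w) = m}. -/

import Mathlib

open scoped ENNReal BigOperators
open Set Filter

/-- Plane (ordered rooted) trees. -/
inductive PlaneTree : Type
  | node : List PlaneTree → PlaneTree

namespace PlaneTree

/-- The list of subtrees hanging off the root. -/
def children : PlaneTree → List PlaneTree
  | .node ts => ts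

/-- The subtree rooted at a given position (sequence of child indices), if it exists. -/
def subtreeAt : PlaneTree → List ℕ → Option PlaneTree
  | t, [] => some t
  | .node ts, i :: q =>
    match ts[i]? with
    | some t' => subtreeAt t' q
    | none => none

/-- The vertex set of a tree, with vertices identified with their positions. -/
def vertexSet (t : PlaneTree) : Set (List ℕ) := {q | (subtreeAt t q).isSome}

/-- The number of vertices of a tree. -/
noncomputable def size (t : PlaneTree) : ℕ := (vertexSet t).ncard

/-- The number of children of the vertex at position `q`. -/
def childCount (t : PlaneTree) (q : List ℕ) : ℕ :=
  ((subtreeAt t q).map fun t' => t'.children.length).getD 0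

end PlaneTree

/-- Longest common prefix of two positions; this is the position of the last common
ancestor of the two vertices. -/
def lca : List ℕ → List ℕ → List ℕ
  | a :: as, b :: bs => if a = b then a :: lca as bs else []
  | _, _ => []

/-- The distance from `v` up to the last common ancestor of `v` and `w`. -/
def dUp (v w : List ℕ) : ℕ := v.length - (lca v w).length

/-- The graph distance between the vertices at positions `v` and `w`. -/
def treeDist (v w : List ℕ) : ℕ := dUp v w + dUp w v

/-- The Galton–Watson probability of a given finite tree: the product, over all vertices,
of the probability that the offspring distribution takes the value given by the number of
children of the vertex. -/
noncomputable def gwProb (p : ℕ → ℝ≥0∞) (t : PlaneTree) : ℝ≥0∞ :=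
  ∏ᶠ v ∈ PlaneTree.vertexSet t, p (PlaneTree.childCount t v)

/-- `P(|𝒯| = n)` for the Galton–Watson tree `𝒯`. -/
noncomputable def probSize (p : ℕ → ℝ≥0∞) (n : ℕ) : ℝ≥0∞ :=
  ∑' t : PlaneTree, if PlaneTree.size t = n then gwProb p t else 0

/-- `E f(T_n)` where `T_n` is the Galton–Watson tree conditioned to have `n` vertices. -/
noncomputable def condExp (p : ℕ → ℝ≥0∞) (n : ℕ) (f : PlaneTree → ℝ≥0∞) : ℝ≥0∞ :=
  (∑' t : PlaneTree, if PlaneTree.size t = n then gwProb p t * f t else 0) / probSize p n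

/-- The variance of the offspring distribution `p` (which has mean `1`). -/
noncomputable def xiVar (p : ℕ → ℝ≥0∞) : ℝ≥0∞ :=
  ∑' k : ℕ, p k * ENNReal.ofReal (((k : ℝ) - 1) ^ 2)

/-- `P_k(t)`: the number of unordered pairs of vertices of `t` at graph distance `k`. -/
noncomputable def pairCount (t : PlaneTree) (k : ℕ) : ℕ :=
  {s : Set (List ℕ) | ∃ v w, v ∈ PlaneTree.vertexSet t ∧ w ∈ PlaneTree.vertexSet t ∧
    s = {v, w} ∧ treeDist v w = k}.ncard

/-- `Y_{ℓ,m}(t)`: the number of ordered pairs `(v, w)` of vertices of `t` with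
`d(v, v∧w) = ℓ` and `d(w, v∧w) = m`. -/
noncomputable def orderedPairCount (t : PlaneTree) (l m : ℕ) : ℕ :=
  {vw : List ℕ × List ℕ | vw.1 ∈ PlaneTree.vertexSet t ∧ vw.2 ∈ PlaneTree.vertexSet t ∧
    dUp vw.1 vw.2 = l ∧ dUp vw.2 vw.1 = m}.ncard

section FormalComposition

open PowerSeries

/-- Formal composition `c(F)` of power series over `ℝ≥0∞`, where infinite sums of coefficients
always make sense. -/
noncomputable def comp (F c : ℝ≥0∞⟦X⟧) : ℝ≥0∞⟦X⟧ :=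
  PowerSeries.mk fun n => ∑' i, coeff i c * coeff n (F ^ i)

/-- The value `∑ cᵢ xⁱ` of a power series at a point of `ℝ≥0∞`. -/
noncomputable def evalAt (x : ℝ≥0∞) (c : ℝ≥0∞⟦X⟧) : ℝ≥0∞ := ∑' i, coeff i c * x ^ i

lemma coeff_comp (F c : ℝ≥0∞⟦X⟧) (n : ℕ) :
    coeff n (comp F c) = ∑' i, coeff i c * coeff n (F ^ i) := by
  simp [comp]

lemma coeff_comp_mul (F c B : ℝ≥0∞⟦X⟧) (n : ℕ) :
    coeff n (comp F c * B) = ∑' i, coeff i c * coeff n (F ^ i * B) := by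
  simp_rw [coeff_mul, coeff_comp, Finset.mul_sum, ← ENNReal.tsum_mul_right]
  rw [Summable.tsum_finsetSum (fun _ _ => ENNReal.summable)]
  simp_rw [mul_assoc]

lemma tsum_coeff_mul (c d : ℝ≥0∞⟦X⟧) (f : ℕ → ℝ≥0∞) :
    ∑' n, coeff n (c * d) * f n = ∑' i, ∑' j, coeff i c * coeff j d * f (i + j) := by
  rw [← ENNReal.tsum_prod (f := fun i j => coeff i c * coeff j d * f (i + j)),
    ← Finset.HasAntidiagonal.sigmaAntidiagonalEquivProd.tsum_eq, ENNReal.tsum_sigma']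
  refine tsum_congr fun n => ?_
  rw [coeff_mul, Finset.sum_mul, tsum_fintype, ← Finset.sum_coe_sort]
  refine Finset.sum_congr rfl fun x _ => ?_
  have := Finset.HasAntidiagonal.mem_antidiagonal.1 x.2
  simp [Finset.HasAntidiagonal.sigmaAntidiagonalEquivProd, this]

lemma comp_mul (F c d : ℝ≥0∞⟦X⟧) : comp F (c * d) = comp F c * comp F d := by
  ext n
  rw [coeff_comp, tsum_coeff_mul, coeff_comp_mul]
  refine tsum_congr fun i => ?_
  rw [mul_comm (F ^ i), coeff_comp_mul, ← ENNReal.tsum_mul_left]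
  refine tsum_congr fun j => ?_
  rw [mul_assoc, ← pow_add, add_comm j]

lemma comp_X (F : ℝ≥0∞⟦X⟧) : comp F X = F := by
  ext n
  rw [coeff_comp, tsum_eq_single 1]
  · simp
  · intro b hb
    simp [coeff_X, hb]

lemma comp_one (F : ℝ≥0∞⟦X⟧) : comp F 1 = 1 := by
  ext n
  rw [coeff_comp, tsum_eq_single 0]
  · simp
  · intro b hb
    simp [coeff_one, hb]

lemma comp_pow (F c : ℝ≥0∞⟦X⟧) (k : ℕ) : comp F (c ^ k) = comp F c ^ k := by
  induction k with
  | zero => simp [comp_one]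
  | succ k ih => rw [pow_succ, comp_mul, ih, pow_succ]

lemma derivative_comp (F c : ℝ≥0∞⟦X⟧) :
    derivative ℝ≥0∞ (comp F c) = comp F (derivative ℝ≥0∞ c) * derivative ℝ≥0∞ F := by
  ext n
  rw [coeff_derivative, coeff_comp, coeff_comp_mul, ← ENNReal.tsum_mul_right,
    tsum_eq_zero_add' ENNReal.summable]
  simp only [pow_zero, coeff_one, Nat.succ_ne_zero, if_false, mul_zero, zero_mul, zero_add]
  refine tsum_congr fun i => ?_
  rw [mul_assoc, ← coeff_derivative, derivative_pow, coeff_derivative]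
  have : ((i + 1 : ℕ) : ℝ≥0∞⟦X⟧) = C ((i : ℝ≥0∞) + 1) := by simp
  rw [this, mul_assoc, coeff_C_mul, Nat.add_sub_cancel, mul_assoc]

lemma evalAt_mul (x : ℝ≥0∞) (c d : ℝ≥0∞⟦X⟧) : evalAt x (c * d) = evalAt x c * evalAt x d := by
  rw [evalAt, tsum_coeff_mul, evalAt, evalAt, ← ENNReal.tsum_mul_right]
  refine tsum_congr fun i => ?_
  rw [← ENNReal.tsum_mul_left]
  refine tsum_congr fun j => ?_
  ring

lemma evalAt_X (x : ℝ≥0∞) : evalAt x X = x := by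
  rw [evalAt, tsum_eq_single 1]
  · simp
  · intro b hb
    simp [coeff_X, hb]

lemma evalAt_pow (x : ℝ≥0∞) (c : ℝ≥0∞⟦X⟧) (k : ℕ) : evalAt x (c ^ k) = evalAt x c ^ k := by
  induction k with
  | zero =>
    rw [pow_zero, pow_zero, evalAt, tsum_eq_single 0]
    · simp
    · intro b hb
      simp [coeff_one, hb]
  | succ k ih => rw [pow_succ, evalAt_mul, ih, pow_succ]

/-- A linear fixed point equation `G = Q G + H` with `Q(0) = 0` has at most one solution. -/
lemma eq_of_eq_mul_add {Q H G G' : ℝ≥0∞⟦X⟧} (hQ : coeff 0 Q = 0) (hG : G = Q * G + H)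
    (hG' : G' = Q * G' + H) : G = G' := by
  ext n
  induction n using Nat.strong_induction_on with
  | _ n ih =>
    rw [hG, hG', map_add, map_add, coeff_mul, coeff_mul]
    congr 1
    refine Finset.sum_congr rfl fun x hx => ?_
    have hx := Finset.HasAntidiagonal.mem_antidiagonal.1 hx
    rcases Nat.eq_zero_or_pos x.1 with h | h
    · rw [h, hQ, zero_mul, zero_mul]
    · rw [ih x.2 (by omega)]

variable {F Φ : ℝ≥0∞⟦X⟧}

lemma coeff_pow_eq_zero (hF : F = X * comp F Φ) {n K : ℕ} (h : n < K) : coeff n (F ^ K) = 0 := by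
  conv_lhs => rw [hF]
  rw [mul_pow, coeff_X_pow_mul', if_neg (by omega)]

lemma coeff_succ_pow_succ (hF : F = X * comp F Φ) (n K : ℕ) :
    coeff (n + 1) (F ^ (K + 1)) = ∑' j, coeff j Φ * coeff n (F ^ (K + j)) := by
  have : F ^ (K + 1) = X * (comp F Φ * F ^ K) := by
    conv_lhs => rw [pow_succ']
    conv_lhs => enter [1]; rw [hF]
    rw [mul_assoc]
  rw [this, coeff_succ_X_mul, coeff_comp_mul]
  simp_rw [← pow_add, add_comm]

/-- Exchangeability: `(N + 1) E[ξ₁; S_{N+1} = s] = s P(S_{N+1} = s)`. -/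
lemma sum_mul_coeff_pow (Φ : ℝ≥0∞⟦X⟧) (N s : ℕ) :
    (N + 1 : ℝ≥0∞) * ∑ x ∈ Finset.HasAntidiagonal.antidiagonal s,
        x.1 * (coeff x.1 Φ * coeff x.2 (Φ ^ N)) =
      s * coeff s (Φ ^ (N + 1)) := by
  have h1 : ∀ (c : ℝ≥0∞⟦X⟧) (s : ℕ), coeff s (X * derivative ℝ≥0∞ c) = s * coeff s c := by
    intro c s
    cases s with
    | zero => simp
    | succ s => rw [coeff_succ_X_mul, coeff_derivative, mul_comm]; push_cast; rfl
  rw [← h1, derivative_pow, Nat.add_sub_cancel]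
  have : ((N + 1 : ℕ) : ℝ≥0∞⟦X⟧) = C ((N : ℝ≥0∞) + 1) := by simp
  rw [this, mul_assoc, mul_left_comm, coeff_C_mul, mul_left_comm, mul_comm (Φ ^ N), coeff_mul]
  simp_rw [h1, mul_assoc]

/-- The Lagrange inversion formula (Otter–Dwass formula for forests). -/
lemma lagrange_inversion (hF : F = X * comp F Φ) (n K s : ℕ) (h : s + K = n) :
    (n : ℝ≥0∞) * coeff n (F ^ K) = K * coeff s (Φ ^ n) := by
  induction n generalizing K s with
  | zero =>
    obtain ⟨rfl, rfl⟩ : s = 0 ∧ K = 0 := by omega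
    simp
  | succ n ih =>
    cases K with
    | zero => simp [coeff_one]
    | succ K =>
      have hs : s + K = n := by omega
      rw [coeff_succ_pow_succ hF]
      rcases Nat.eq_zero_or_pos n with rfl | hn
      · obtain ⟨rfl, rfl⟩ : s = 0 ∧ K = 0 := by omega
        rw [tsum_eq_single 0]
        · simp
        · intro b hb
          rw [coeff_pow_eq_zero hF (show 0 < 0 + b by omega), mul_zero]
      have hfin : ∑' j, coeff j Φ * coeff n (F ^ (K + j)) =
          ∑ x ∈ Finset.HasAntidiagonal.antidiagonal s, coeff x.1 Φ * coeff n (F ^ (K + x.1)) := by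
        rw [Finset.Nat.sum_antidiagonal_eq_sum_range_succ
          (fun a _ => coeff a Φ * coeff n (F ^ (K + a)))]
        refine tsum_eq_sum fun b hb => ?_
        rw [coeff_pow_eq_zero hF, mul_zero]
        simp at hb; omega
      rw [hfin]
      have hn0 : (n : ℝ≥0∞) ≠ 0 := by simpa using hn.ne'
      have hnt : (n : ℝ≥0∞) ≠ ⊤ := ENNReal.natCast_ne_top n
      refine (ENNReal.mul_right_inj hn0 hnt).1 ?_
      have hstep : (n : ℝ≥0∞) * ∑ x ∈ Finset.HasAntidiagonal.antidiagonal s,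
          coeff x.1 Φ * coeff n (F ^ (K + x.1)) =
          K * coeff s (Φ ^ (n + 1)) +
          ∑ x ∈ Finset.HasAntidiagonal.antidiagonal s, x.1 * (coeff x.1 Φ * coeff x.2 (Φ ^ n)) := by
        rw [pow_succ', coeff_mul, Finset.mul_sum, Finset.mul_sum, ← Finset.sum_add_distrib]
        refine Finset.sum_congr rfl fun x hx => ?_
        have hx := Finset.HasAntidiagonal.mem_antidiagonal.1 hx
        rw [mul_left_comm, ih (K + x.1) x.2 (by omega)]
        push_cast
        ring
      rw [mul_left_comm, hstep, mul_add]
      push_cast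
      rw [sum_mul_coeff_pow, ← mul_assoc, ← add_mul, ← mul_assoc]
      congr 1
      rw [← hs]
      push_cast
      ring

/-- Pointing a vertex of a forest: `[z^N] (z F' F^i) = [x^{N-i-1}] Φ^N`. -/
lemma coeff_pow_mul_X_mul_derivative (hF : F = X * comp F Φ) (i N s : ℕ) (h : s + i + 1 = N) :
    coeff N (F ^ i * (X * derivative ℝ≥0∞ F)) = coeff s (Φ ^ N) := by
  have h0 : ((i : ℝ≥0∞) + 1) ≠ 0 := by simp
  have ht : ((i : ℝ≥0∞) + 1) ≠ ⊤ := by simp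
  refine (ENNReal.mul_right_inj h0 ht).1 ?_
  have := lagrange_inversion hF N (i + 1) s (by omega)
  push_cast at this
  rw [← this]
  have hC : ((i + 1 : ℕ) : ℝ≥0∞⟦X⟧) = C ((i : ℝ≥0∞) + 1) := by simp
  have hd := derivative_pow F (i + 1)
  rw [hC, Nat.add_sub_cancel] at hd
  obtain ⟨M, rfl⟩ : ∃ M, N = M + 1 := ⟨N - 1, by omega⟩
  rw [← coeff_C_mul, ← mul_assoc, mul_left_comm, ← hd, coeff_succ_X_mul, coeff_derivative, mul_comm]
  push_cast
  rfl

lemma coeff_pow_mul_X_mul_derivative_eq_zero (hF : F = X * comp F Φ) (i N : ℕ) (h : N < i + 1) :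
    coeff N (F ^ i * (X * derivative ℝ≥0∞ F)) = 0 := by
  conv_lhs => enter [2, 1]; rw [hF]
  rw [mul_pow, show (X ^ i * comp F Φ ^ i * (X * derivative ℝ≥0∞ F) : ℝ≥0∞⟦X⟧) =
    X ^ (i + 1) * (comp F Φ ^ i * derivative ℝ≥0∞ F) by ring, coeff_X_pow_mul', if_neg (by omega)]

/-- Solution of the linear equation for the generating function of an additive functional. -/
lemma eq_mul_X_mul_derivative {G B : ℝ≥0∞⟦X⟧} (hF : F = X * comp F Φ)
    (hG : G = X * comp F (derivative ℝ≥0∞ Φ) * G + B * F) : G = B * (X * derivative ℝ≥0∞ F) := by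
  refine eq_of_eq_mul_add (by simp) hG ?_
  have hd : derivative ℝ≥0∞ F =
      comp F Φ + X * (comp F (derivative ℝ≥0∞ Φ) * derivative ℝ≥0∞ F) := by
    conv_lhs => rw [hF]
    rw [Derivation.leibniz, derivative_X, derivative_comp]
    simp [add_comm]
  have hd' : X * derivative ℝ≥0∞ F =
      F + X * (X * (comp F (derivative ℝ≥0∞ Φ) * derivative ℝ≥0∞ F)) := by
    conv_lhs => rw [hd]
    rw [mul_add, ← hF]
  conv_lhs => rw [hd']
  ring

end FormalComposition

namespace PlaneTree

lemma induction_ofFn {P : PlaneTree → Prop}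
    (h : ∀ (j : ℕ) (f : Fin j → PlaneTree), (∀ i, P (f i)) → P (node (List.ofFn f)))
    (t : PlaneTree) : P t := by
  refine PlaneTree.rec (motive_1 := P) (motive_2 := fun ts => ∀ t ∈ ts, P t) ?_ ?_ ?_ t
  · intro ts hts
    have := h ts.length ts.get fun i => hts _ (List.get_mem ts i)
    rwa [List.ofFn_get] at this
  · simp
  · intro a ts ha hts t ht
    rcases List.mem_cons.1 ht with rfl | ht
    · exact ha
    · exact hts t ht

lemma subtreeAt_nil (t : PlaneTree) : subtreeAt t [] = some t := by
  rw [subtreeAt]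

lemma subtreeAt_ofFn_cons {j : ℕ} (f : Fin j → PlaneTree) (i : Fin j) (q : List ℕ) :
    subtreeAt (node (List.ofFn f)) (i :: q) = subtreeAt (f i) q := by
  rw [subtreeAt]
  simp

lemma vertexSet_ofFn {j : ℕ} (f : Fin j → PlaneTree) :
    vertexSet (node (List.ofFn f)) =
      insert [] (⋃ i : Fin j, List.cons (i : ℕ) '' vertexSet (f i)) := by
  ext q
  cases q with
  | nil => simp [vertexSet, subtreeAt_nil]
  | cons i q =>
    by_cases hi : i < j
    · have := subtreeAt_ofFn_cons f ⟨i, hi⟩ q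
      simp only at this
      simp only [vertexSet, mem_ofPred_eq, this, mem_insert_iff, reduceCtorEq, mem_iUnion,
        mem_image,
        List.cons.injEq, false_or]
      constructor
      · intro h
        exact ⟨⟨i, hi⟩, q, h, rfl, rfl⟩
      · rintro ⟨i', x, hx, rfl, rfl⟩
        exact hx
    · simp only [vertexSet, mem_ofPred_eq, mem_insert_iff, reduceCtorEq, mem_iUnion,
        mem_image,
        List.cons.injEq, false_or]
      constructor
      · intro h
        rw [subtreeAt] at h
        simp [hi] at h
      · rintro ⟨i', x, hx, rfl, rfl⟩
        exact absurd i'.2 hi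

lemma finite_vertexSet (t : PlaneTree) : (vertexSet t).Finite := by
  induction t using induction_ofFn with
  | h j f ih =>
    rw [vertexSet_ofFn]
    exact (finite_iUnion fun i => (ih i).image _).insert _

/-- The vertex set of a tree as a `Finset`. -/
noncomputable def verts (t : PlaneTree) : Finset (List ℕ) := (finite_vertexSet t).toFinset

lemma mem_verts {t : PlaneTree} {v : List ℕ} : v ∈ verts t ↔ v ∈ vertexSet t := by
  simp [verts]

lemma verts_ofFn {j : ℕ} (f : Fin j → PlaneTree) :
    verts (node (List.ofFn f)) =
      insert [] (Finset.univ.biUnion fun i : Fin j => (verts (f i)).image (List.cons (i : ℕ))) := by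
  ext v
  simp [mem_verts, vertexSet_ofFn]

@[to_additive]
lemma prod_verts_ofFn {M : Type*} [CommMonoid M] {j : ℕ} (f : Fin j → PlaneTree)
    (g : List ℕ → M) :
    ∏ v ∈ verts (node (List.ofFn f)), g v = g [] * ∏ i, ∏ v ∈ verts (f i), g (i :: v) := by
  rw [verts_ofFn, Finset.prod_insert (by simp), Finset.prod_biUnion]
  · congr 1
    refine Finset.prod_congr rfl fun i _ => ?_
    rw [Finset.prod_image (by simp)]
  · intro i _ i' _ hne
    simp only [Function.onFun, Finset.disjoint_left, Finset.mem_image]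
    rintro _ ⟨x, _, rfl⟩ ⟨y, _, hxy⟩
    simp only [List.cons.injEq] at hxy
    exact hne (Fin.ext hxy.1.symm)

lemma size_eq_card (t : PlaneTree) : size t = (verts t).card :=
  Set.ncard_eq_toFinset_card _ _

lemma size_ofFn {j : ℕ} (f : Fin j → PlaneTree) :
    size (node (List.ofFn f)) = (∑ i, size (f i)) + 1 := by
  simp_rw [size_eq_card, Finset.card_eq_sum_ones]
  rw [sum_verts_ofFn, add_comm]

lemma childCount_ofFn_nil {j : ℕ} (f : Fin j → PlaneTree) :
    childCount (node (List.ofFn f)) [] = j := by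
  simp [childCount, subtreeAt_nil, children]

lemma childCount_ofFn_cons {j : ℕ} (f : Fin j → PlaneTree) (i : Fin j) (q : List ℕ) :
    childCount (node (List.ofFn f)) (i :: q) = childCount (f i) q := by
  rw [childCount, subtreeAt_ofFn_cons, childCount]

lemma gwProb_eq_prod (p : ℕ → ℝ≥0∞) (t : PlaneTree) :
    gwProb p t = ∏ v ∈ verts t, p (childCount t v) :=
  finprod_mem_eq_finite_toFinset_prod _ _

lemma gwProb_ofFn (p : ℕ → ℝ≥0∞) {j : ℕ} (f : Fin j → PlaneTree) :
    gwProb p (node (List.ofFn f)) = p j * ∏ i, gwProb p (f i) := by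
  simp_rw [gwProb_eq_prod, prod_verts_ofFn, childCount_ofFn_nil, childCount_ofFn_cons]

/-- The number of vertices at depth `l`. -/
noncomputable def levelCount (l : ℕ) (t : PlaneTree) : ℝ≥0∞ :=
  ∑ v ∈ verts t, if v.length = l then 1 else 0

lemma levelCount_zero (t : PlaneTree) : levelCount 0 t = 1 := by
  induction t using induction_ofFn with
  | h j f _ =>
    rw [levelCount, sum_verts_ofFn]
    simp

lemma levelCount_succ_ofFn (l : ℕ) {j : ℕ} (f : Fin j → PlaneTree) :
    levelCount (l + 1) (node (List.ofFn f)) = ∑ i, levelCount l (f i) := by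
  rw [levelCount, sum_verts_ofFn]
  simp [levelCount]

lemma orderedPairCount_eq_card (t : PlaneTree) (l m : ℕ) :
    orderedPairCount t l m =
      ((verts t ×ˢ verts t).filter fun x => dUp x.1 x.2 = l ∧ dUp x.2 x.1 = m).card := by
  rw [orderedPairCount, ← Set.ncard_coe_finset]
  congr 1
  ext x
  simp [mem_verts, and_assoc]

lemma orderedPairCount_eq_sum (t : PlaneTree) (l m : ℕ) :
    (orderedPairCount t l m : ℝ≥0∞) =
      ∑ v ∈ verts t, ∑ w ∈ verts t, if dUp v w = l ∧ dUp w v = m then 1 else 0 := by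
  rw [orderedPairCount_eq_card, ← Finset.sum_product'
    (f := fun v w => if dUp v w = l ∧ dUp w v = m then (1 : ℝ≥0∞) else 0), Finset.sum_boole]

lemma dUp_nil_left (w : List ℕ) : dUp [] w = 0 := by
  simp [dUp]

lemma dUp_cons_cons_self (i : ℕ) (v w : List ℕ) : dUp (i :: v) (i :: w) = dUp v w := by
  simp [dUp, lca]

lemma dUp_cons_cons_of_ne {i j : ℕ} (h : i ≠ j) (v w : List ℕ) :
    dUp (i :: v) (j :: w) = v.length + 1 := by
  simp [dUp, lca, h]

lemma orderedPairCount_succ_ofFn (l m : ℕ) {j : ℕ} (f : Fin j → PlaneTree) :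
    (orderedPairCount (node (List.ofFn f)) (l + 1) (m + 1) : ℝ≥0∞) =
      (∑ i, (orderedPairCount (f i) (l + 1) (m + 1) : ℝ≥0∞)) +
      ∑ i, ∑ i' ∈ Finset.univ.erase i, levelCount l (f i) * levelCount m (f i') := by
  rw [orderedPairCount_eq_sum, sum_verts_ofFn]
  simp_rw [sum_verts_ofFn, dUp_nil_left]
  simp only [and_false, false_and, if_false,
    (Nat.succ_ne_zero _).symm, Finset.sum_const_zero, add_zero, zero_add]
  rw [← Finset.sum_add_distrib]
  refine Finset.sum_congr rfl fun i _ => ?_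
  rw [Finset.sum_comm, ← Finset.add_sum_erase _ _ (Finset.mem_univ i), orderedPairCount_eq_sum]
  congr 1
  · simp_rw [dUp_cons_cons_self]
  · refine Finset.sum_congr rfl fun i' hi' => ?_
    have hne : (i' : ℕ) ≠ i := fun h => Finset.ne_of_mem_erase hi' (Fin.ext h)
    simp_rw [dUp_cons_cons_of_ne hne, dUp_cons_cons_of_ne hne.symm, levelCount,
      Finset.sum_mul_sum, Nat.add_right_cancel_iff]
    refine Finset.sum_congr rfl fun v _ => Finset.sum_congr rfl fun w _ => ?_
    split_ifs <;> simp_all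

lemma orderedPairCount_swap (t : PlaneTree) (l m : ℕ) :
    orderedPairCount t l m = orderedPairCount t m l := by
  rw [orderedPairCount_eq_card, orderedPairCount_eq_card]
  refine Finset.card_bij' (fun x _ => x.swap) (fun x _ => x.swap) ?_ ?_ ?_ ?_ <;>
    simp +contextual

lemma lca_length_comm (v w : List ℕ) : (lca v w).length = (lca w v).length := by
  induction v generalizing w with
  | nil => cases w <;> simp [lca]
  | cons a v ih =>
    cases w with
    | nil => simp [lca]
    | cons b w =>
      by_cases h : a = b
      · simp [lca, h, ih]
      · simp [lca, h, Ne.symm h]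

lemma lca_prefix_left (v w : List ℕ) : lca v w <+: v := by
  induction v generalizing w with
  | nil => cases w <;> simp [lca]
  | cons a v ih =>
    cases w with
    | nil => simp [lca]
    | cons b w =>
      by_cases h : a = b
      · simpa [lca, h] using ih w
      · simp [lca, h]

lemma lca_prefix_right (v w : List ℕ) : lca v w <+: w := by
  induction v generalizing w with
  | nil => cases w <;> simp [lca]
  | cons a v ih =>
    cases w with
    | nil => simp [lca]
    | cons b w =>
      by_cases h : a = b
      · simpa [lca, h] using ih w
      · simp [lca, h]

/-- A vertex is determined by a descendant and their distance. -/
lemma eq_take_of_dUp_eq_zero {v w : List ℕ} (h : dUp v w = 0) :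
    v = w.take (w.length - dUp w v) := by
  have h1 : v.length = (lca v w).length :=
    le_antisymm (Nat.sub_eq_zero_iff_le.1 h) (lca_prefix_left v w).length_le
  have h2 : lca v w = v := (lca_prefix_left v w).eq_of_length h1.symm
  have h3 : v <+: w := h2 ▸ lca_prefix_right v w
  have h4 := h3.length_le
  rw [dUp, ← lca_length_comm, ← h1, Nat.sub_sub_self h4]
  exact List.prefix_iff_eq_take.1 h3

lemma orderedPairCount_zero_le (t : PlaneTree) (m : ℕ) : orderedPairCount t 0 m ≤ size t := by
  rw [orderedPairCount_eq_card, size_eq_card]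
  refine Finset.card_le_card_of_injOn Prod.snd ?_ ?_
  · intro x hx
    simp at hx
    exact hx.1.2
  · intro x hx y hy hxy
    simp at hx hy
    refine Prod.ext ?_ hxy
    rw [eq_take_of_dUp_eq_zero hx.2.1, eq_take_of_dUp_eq_zero hy.2.1, hx.2.2, hy.2.2, hxy]

lemma orderedPairCount_le_sq (t : PlaneTree) (l m : ℕ) :
    orderedPairCount t l m ≤ size t ^ 2 := by
  rw [orderedPairCount_eq_card, size_eq_card, sq, ← Finset.card_product]
  exact Finset.card_filter_le _ _

/-- The generating function of the weights `gwProb p t * f t` by size of `t`. -/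
noncomputable def genFun (p : ℕ → ℝ≥0∞) (f : PlaneTree → ℝ≥0∞) : PowerSeries ℝ≥0∞ :=
  PowerSeries.mk fun n => ∑' t : PlaneTree, if size t = n then gwProb p t * f t else 0

/-- Trees as finite families of trees. -/
def equivSigma : PlaneTree ≃ Σ j, Fin j → PlaneTree where
  toFun t := List.equivSigmaTuple t.children
  invFun f := node (List.equivSigmaTuple.symm f)
  left_inv t := by cases t; simp [children]
  right_inv f := by simp only [children, Equiv.apply_symm_apply]

lemma tsum_eq_tsum_ofFn (g : PlaneTree → ℝ≥0∞) :
    ∑' t, g t = ∑' j, ∑' f : Fin j → PlaneTree, g (node (List.ofFn f)) := by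
  rw [← equivSigma.symm.tsum_eq, ENNReal.tsum_sigma']
  rfl

open PowerSeries in
/-- The generating function of a product functional on tuples is the product of the generating
functions. -/
lemma coeff_prod_genFun (p : ℕ → ℝ≥0∞) {j : ℕ} (h : Fin j → PlaneTree → ℝ≥0∞) (n : ℕ) :
    coeff n (∏ i, genFun p (h i)) =
      ∑' f : Fin j → PlaneTree,
        if ∑ i, size (f i) = n then ∏ i, (gwProb p (f i) * h i (f i)) else 0 := by
  induction j generalizing n with
  | zero =>
    rw [tsum_eq_single default (fun b hb => absurd (Subsingleton.elim _ _) hb)]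
    simp [coeff_one, eq_comm]
  | succ j ih =>
    rw [Fin.prod_univ_succ, coeff_mul, ← (Fin.consEquiv fun _ => PlaneTree).tsum_eq,
      ENNReal.tsum_prod']
    simp_rw [ih, genFun, coeff_mk, Fin.consEquiv_apply, Fin.sum_univ_succ, Fin.prod_univ_succ,
      Fin.cons_zero, Fin.cons_succ, ← ENNReal.tsum_mul_right, ← ENNReal.tsum_mul_left]
    rw [← Summable.tsum_finsetSum (fun _ _ => ENNReal.summable)]
    refine tsum_congr fun t => ?_
    rw [← Summable.tsum_finsetSum (fun _ _ => ENNReal.summable)]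
    refine tsum_congr fun f => ?_
    by_cases hn : size t + ∑ i, size (f i) = n
    · rw [if_pos hn, Finset.sum_eq_single (size t, ∑ i, size (f i))]
      · simp
      · rintro ⟨a, b⟩ _ hne
        by_cases ha : size t = a
        · by_cases hb : ∑ i, size (f i) = b
          · subst ha hb; exact absurd rfl hne
          · simp [hb]
        · simp [ha]
      · intro hnot
        exact absurd (Finset.HasAntidiagonal.mem_antidiagonal.2 hn) hnot
    · rw [if_neg hn]
      refine Finset.sum_eq_zero ?_
      rintro ⟨a, b⟩ hab
      have hab := Finset.HasAntidiagonal.mem_antidiagonal.1 hab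
      by_cases ha : size t = a
      · by_cases hb : ∑ i, size (f i) = b
        · subst ha hb; exact absurd hab hn
        · simp [hb]
      · simp [ha]

section GeneratingFunctions

open PowerSeries

variable (p : ℕ → ℝ≥0∞)

lemma coeff_pow_genFun_one (j n : ℕ) :
    coeff n (genFun p 1 ^ j) = ∑' f : Fin j → PlaneTree,
      if ∑ i, size (f i) = n then (∏ i, gwProb p (f i)) * 1 else 0 := by
  have := coeff_prod_genFun p (fun _ : Fin j => 1) n
  simpa using this

lemma coeff_sum_genFun (u : PlaneTree → ℝ≥0∞) (j n : ℕ) :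
    coeff n (genFun p 1 ^ (j - 1) * genFun p u) * j = ∑' f : Fin j → PlaneTree,
      if ∑ i, size (f i) = n then (∏ i, gwProb p (f i)) * ∑ i, u (f i) else 0 := by
  have h1 : ∀ i : Fin j, coeff n (genFun p 1 ^ (j - 1) * genFun p u) =
      ∑' f : Fin j → PlaneTree,
        if ∑ i, size (f i) = n then (∏ i, gwProb p (f i)) * u (f i) else 0 := by
    intro i
    have h2 := coeff_prod_genFun p (fun i' t => if i' = i then u t else 1) n
    rw [← Finset.mul_prod_erase _ _ (Finset.mem_univ i), Finset.prod_congr rfl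
      (g := fun _ => genFun p 1) (fun x hx => by simp [Finset.ne_of_mem_erase hx]; rfl)] at h2
    simp_rw [Finset.prod_mul_distrib, Finset.prod_ite_eq' Finset.univ i] at h2
    simpa [mul_comm] using h2
  have h3 : coeff n (genFun p 1 ^ (j - 1) * genFun p u) * j =
      ∑ i : Fin j, coeff n (genFun p 1 ^ (j - 1) * genFun p u) := by
    rw [Finset.sum_const, Finset.card_fin, nsmul_eq_mul, mul_comm]
  rw [h3, Finset.sum_congr rfl fun i _ => h1 i,
    ← Summable.tsum_finsetSum (fun _ _ => ENNReal.summable)]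
  refine tsum_congr fun f => ?_
  split_ifs
  · rw [Finset.mul_sum]
  · simp

lemma coeff_sum_erase_genFun (u v : PlaneTree → ℝ≥0∞) (j n : ℕ) :
    coeff n (genFun p 1 ^ (j - 2) * (genFun p u * genFun p v)) * (j * (j - 1 : ℕ)) =
      ∑' f : Fin j → PlaneTree,
        if ∑ i, size (f i) = n then
          (∏ i, gwProb p (f i)) * ∑ i, ∑ i' ∈ Finset.univ.erase i, u (f i) * v (f i') else 0 := by
  have h1 : ∀ i : Fin j, ∀ i' ∈ Finset.univ.erase i,
      coeff n (genFun p 1 ^ (j - 2) * (genFun p u * genFun p v)) =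
      ∑' f : Fin j → PlaneTree,
        if ∑ i, size (f i) = n then (∏ i, gwProb p (f i)) * (u (f i) * v (f i')) else 0 := by
    intro i i' hi'
    have hne := Finset.ne_of_mem_erase hi'
    have h2 := coeff_prod_genFun p
      (fun k t => (if k = i then u t else 1) * (if k = i' then v t else 1)) n
    rw [← Finset.mul_prod_erase _ _ (Finset.mem_univ i), ← Finset.mul_prod_erase _ _ hi',
      Finset.prod_congr rfl (g := fun _ => genFun p 1) (fun x hx => by
        simp [Finset.ne_of_mem_erase hx, Finset.ne_of_mem_erase (Finset.mem_of_mem_erase hx)]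
        rfl)] at h2
    simp_rw [Finset.prod_mul_distrib, Finset.prod_ite_eq' Finset.univ] at h2
    rw [Finset.prod_const, Finset.card_erase_of_mem hi',
      Finset.card_erase_of_mem (Finset.mem_univ i), Finset.card_fin, Nat.sub_sub] at h2
    simp only [if_true, if_neg hne, if_neg hne.symm, mul_one, one_mul, Finset.mem_univ] at h2
    rw [← h2]
    congr 1
    ring
  have h3 : coeff n (genFun p 1 ^ (j - 2) * (genFun p u * genFun p v)) * (j * (j - 1 : ℕ)) =
      ∑ i : Fin j, ∑ i' ∈ Finset.univ.erase i,
        coeff n (genFun p 1 ^ (j - 2) * (genFun p u * genFun p v)) := by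
    simp only [Finset.sum_const, Finset.card_erase_of_mem (Finset.mem_univ _), Finset.card_fin,
      nsmul_eq_mul]
    ring
  rw [h3, Finset.sum_congr rfl fun i _ => Finset.sum_congr rfl (h1 i)]
  simp_rw [← Summable.tsum_finsetSum (fun _ _ => ENNReal.summable)]
  refine tsum_congr fun f => ?_
  split_ifs
  · simp_rw [Finset.mul_sum]
  · simp

lemma coeff_zero_genFun (g : PlaneTree → ℝ≥0∞) : coeff 0 (genFun p g) = 0 := by
  rw [genFun, coeff_mk, tsum_eq_tsum_ofFn]
  simp [size_ofFn]

lemma coeff_succ_genFun (g : PlaneTree → ℝ≥0∞) (n : ℕ) :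
    coeff (n + 1) (genFun p g) = ∑' j, p j * ∑' f : Fin j → PlaneTree,
      if ∑ i, size (f i) = n then (∏ i, gwProb p (f i)) * g (node (List.ofFn f)) else 0 := by
  rw [genFun, coeff_mk, tsum_eq_tsum_ofFn]
  simp_rw [size_ofFn, gwProb_ofFn, Nat.add_right_cancel_iff, ← ENNReal.tsum_mul_left, mul_ite,
    mul_zero, mul_assoc]

lemma genFun_one_eq : genFun p 1 = X * comp (genFun p 1) (PowerSeries.mk p) := by
  ext n
  cases n with
  | zero => rw [coeff_zero_genFun]; simp
  | succ n =>
    rw [coeff_succ_genFun, coeff_succ_X_mul, coeff_comp]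
    simp_rw [coeff_mk, coeff_pow_genFun_one]
    rfl

lemma coeff_succ_X_mul_comp_derivative_mul (F B : ℝ≥0∞⟦X⟧) (n : ℕ) :
    coeff (n + 1) (X * comp F (derivative ℝ≥0∞ (PowerSeries.mk p)) * B) =
      ∑' j, p j * (coeff n (F ^ (j - 1) * B) * j) := by
  rw [mul_assoc, coeff_succ_X_mul, coeff_comp_mul]
  conv_rhs => rw [tsum_eq_zero_add' ENNReal.summable]
  simp only [Nat.cast_zero, mul_zero, zero_add, coeff_derivative, coeff_mk, Nat.add_sub_cancel]
  refine tsum_congr fun i => ?_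
  push_cast
  ring

lemma coeff_succ_X_mul_comp_derivative_derivative_mul (F B : ℝ≥0∞⟦X⟧) (n : ℕ) :
    coeff (n + 1) (X * comp F (derivative ℝ≥0∞ (derivative ℝ≥0∞ (PowerSeries.mk p))) * B) =
      ∑' j, p j * (coeff n (F ^ (j - 2) * B) * (j * (j - 1 : ℕ))) := by
  rw [mul_assoc, coeff_succ_X_mul, coeff_comp_mul]
  conv_rhs => rw [tsum_eq_zero_add' ENNReal.summable, tsum_eq_zero_add' ENNReal.summable]
  simp only [Nat.cast_zero, mul_zero, zero_mul, zero_add, coeff_derivative, coeff_mk,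
    Nat.add_sub_cancel, Nat.sub_self]
  refine tsum_congr fun i => ?_
  rw [show i + 1 + 1 - 2 = i by omega]
  push_cast
  ring

lemma genFun_levelCount_succ (l : ℕ) :
    genFun p (levelCount (l + 1)) =
      X * comp (genFun p 1) (derivative ℝ≥0∞ (PowerSeries.mk p)) * genFun p (levelCount l) := by
  ext n
  cases n with
  | zero => rw [coeff_zero_genFun]; simp
  | succ n =>
    rw [coeff_succ_genFun, coeff_succ_X_mul_comp_derivative_mul]
    simp_rw [coeff_sum_genFun, levelCount_succ_ofFn]

lemma genFun_levelCount (l : ℕ) :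
    genFun p (levelCount l) =
      (X * comp (genFun p 1) (derivative ℝ≥0∞ (PowerSeries.mk p))) ^ l * genFun p 1 := by
  induction l with
  | zero =>
    rw [pow_zero, one_mul]
    congr 1
    ext t
    rw [levelCount_zero, Pi.one_apply]
  | succ l ih => rw [genFun_levelCount_succ, ih, pow_succ', ← mul_assoc]

lemma genFun_orderedPairCount (l m : ℕ) :
    genFun p (fun t => (orderedPairCount t (l + 1) (m + 1) : ℝ≥0∞)) =
      X * comp (genFun p 1) (derivative ℝ≥0∞ (PowerSeries.mk p)) *
        genFun p (fun t => (orderedPairCount t (l + 1) (m + 1) : ℝ≥0∞)) +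
      X * comp (genFun p 1) (derivative ℝ≥0∞ (derivative ℝ≥0∞ (PowerSeries.mk p))) *
        (genFun p (levelCount l) * genFun p (levelCount m)) := by
  ext n
  cases n with
  | zero => rw [coeff_zero_genFun]; simp
  | succ n =>
    rw [map_add, coeff_succ_genFun, coeff_succ_X_mul_comp_derivative_mul,
      coeff_succ_X_mul_comp_derivative_derivative_mul, ← ENNReal.tsum_add]
    refine tsum_congr fun j => ?_
    rw [← mul_add, coeff_sum_genFun, coeff_sum_erase_genFun, ← ENNReal.tsum_add]
    congr 1
    refine tsum_congr fun f => ?_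
    rw [orderedPairCount_succ_ofFn]
    split_ifs
    · rw [mul_add]
    · rw [add_zero]

/-- The power series recording the number of trees hanging off the two paths that join a pair
of vertices to their last common ancestor. -/
noncomputable def pathSeries (k : ℕ) : ℝ≥0∞⟦X⟧ :=
  X * derivative ℝ≥0∞ (derivative ℝ≥0∞ (PowerSeries.mk p)) *
    derivative ℝ≥0∞ (PowerSeries.mk p) ^ k

lemma genFun_orderedPairCount_eq (l m : ℕ) :
    genFun p (fun t => (orderedPairCount t (l + 1) (m + 1) : ℝ≥0∞)) =
      X ^ (l + m + 1) * (comp (genFun p 1) (pathSeries p (l + m)) *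
        (X * derivative ℝ≥0∞ (genFun p 1))) := by
  have hF := genFun_one_eq p
  have h := genFun_orderedPairCount p l m
  set G := genFun p (fun t => (orderedPairCount t (l + 1) (m + 1) : ℝ≥0∞))
  rw [eq_mul_X_mul_derivative (B := X ^ (l + m + 1) * comp (genFun p 1) (pathSeries p (l + m)))
    (G := G) hF, mul_assoc]
  conv_lhs => rw [h]
  rw [genFun_levelCount, genFun_levelCount, pathSeries, comp_mul, comp_mul, comp_pow, comp_X]
  ring

/-- Exact formula for the weighted count of pairs in trees of size `N + l + m + 1`. -/
lemma coeff_genFun_orderedPairCount (l m N : ℕ) :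
    coeff (N + (l + m + 1)) (genFun p (fun t => (orderedPairCount t (l + 1) (m + 1) : ℝ≥0∞))) =
      ∑ i ∈ Finset.range N,
        coeff i (pathSeries p (l + m)) * coeff (N - 1 - i) (PowerSeries.mk p ^ N) := by
  have hF := genFun_one_eq p
  rw [genFun_orderedPairCount_eq, coeff_X_pow_mul, coeff_comp_mul]
  rw [tsum_eq_sum (s := Finset.range N)]
  · refine Finset.sum_congr rfl fun i hi => ?_
    have := Finset.mem_range.1 hi
    rw [coeff_pow_mul_X_mul_derivative hF i N (N - 1 - i) (by omega)]
  · intro i hi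
    have : ¬ i < N := fun h => hi (Finset.mem_range.2 h)
    rw [coeff_pow_mul_X_mul_derivative_eq_zero hF i N (by omega), mul_zero]

lemma coeff_genFun_orderedPairCount_of_lt (l m n : ℕ) (h : n < l + m + 1) :
    coeff n (genFun p (fun t => (orderedPairCount t (l + 1) (m + 1) : ℝ≥0∞))) = 0 := by
  rw [genFun_orderedPairCount_eq, coeff_X_pow_mul', if_neg (by omega)]

/-- The Otter–Dwass formula. -/
lemma mul_probSize (n : ℕ) :
    ((n + 1 : ℕ) : ℝ≥0∞) * probSize p (n + 1) = coeff n (PowerSeries.mk p ^ (n + 1)) := by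
  have h := lagrange_inversion (genFun_one_eq p) (n + 1) 1 n rfl
  rw [pow_one, Nat.cast_one, one_mul] at h
  rw [← h, genFun, coeff_mk, probSize]
  simp

lemma condExp_eq (n : ℕ) (f : PlaneTree → ℝ≥0∞) :
    condExp p n f = coeff n (genFun p f) / probSize p n := by
  rw [genFun, coeff_mk, condExp]

lemma condExp_le_of_le {n : ℕ} {f : PlaneTree → ℝ≥0∞} {c : ℝ≥0∞}
    (h : ∀ t, size t = n → f t ≤ c) : condExp p n f ≤ c := by
  rw [condExp]
  refine ENNReal.div_le_of_le_mul ?_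
  rw [probSize, ← ENNReal.tsum_mul_left]
  refine ENNReal.tsum_le_tsum fun t => ?_
  split_ifs with ht
  · rw [mul_comm]
    gcongr
    exact h t ht
  · simp

end GeneratingFunctions

end PlaneTree

section LocalLimit

open MeasureTheory Topology
open scoped Real

/-- The characteristic function of a distribution `q` on `ℕ`. -/
noncomputable def natCharFun (q : ℕ → ℝ) (t : ℝ) : ℂ :=
  ∑' k, (q k : ℂ) * Complex.exp (k * t * Complex.I)

lemma norm_exp_natCast_mul_I (k : ℕ) (t : ℝ) : ‖Complex.exp (k * t * Complex.I)‖ = 1 := by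
  have : (k * t * Complex.I : ℂ) = ((k * t : ℝ) : ℂ) * Complex.I := by push_cast; ring
  rw [this, Complex.norm_exp_ofReal_mul_I]

lemma norm_mul_exp (q : ℕ → ℝ) (hq : ∀ k, 0 ≤ q k) (k : ℕ) (t : ℝ) :
    ‖(q k : ℂ) * Complex.exp (k * t * Complex.I)‖ = q k := by
  rw [norm_mul, norm_exp_natCast_mul_I, mul_one, Complex.norm_real, Real.norm_of_nonneg (hq k)]

lemma summable_mul_exp {q : ℕ → ℝ} (hq : ∀ k, 0 ≤ q k) (hs : Summable q) (t : ℝ) :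
    Summable fun k => (q k : ℂ) * Complex.exp (k * t * Complex.I) := by
  refine Summable.of_norm ?_
  simpa only [norm_mul_exp q hq] using hs

lemma continuous_natCharFun {q : ℕ → ℝ} (hq : ∀ k, 0 ≤ q k) (hs : Summable q) :
    Continuous (natCharFun q) := by
  refine continuous_tsum (fun k => by fun_prop) hs fun k t => ?_
  rw [norm_mul_exp q hq]

lemma coeff_pow_nonneg {q : ℕ → ℝ} (hq : ∀ k, 0 ≤ q k) (N s : ℕ) :
    0 ≤ PowerSeries.coeff s (PowerSeries.mk q ^ N) := by
  induction N generalizing s with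
  | zero => rw [pow_zero, PowerSeries.coeff_one]; split_ifs <;> norm_num
  | succ N ih =>
    rw [pow_succ, PowerSeries.coeff_mul]
    exact Finset.sum_nonneg fun x _ => mul_nonneg (ih _) (by simpa using hq _)

lemma hasSum_coeff_pow {q : ℕ → ℝ} (hq : ∀ k, 0 ≤ q k) (hs : Summable q) (N : ℕ) :
    Summable (fun s => PowerSeries.coeff s (PowerSeries.mk q ^ N)) ∧ ∀ t : ℝ,
      HasSum (fun s => ((PowerSeries.coeff s (PowerSeries.mk q ^ N) : ℝ) : ℂ) *
        Complex.exp (s * t * Complex.I)) (natCharFun q t ^ N) := by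
  induction N with
  | zero =>
    constructor
    · refine summable_of_ne_finset_zero (s := {0}) fun b hb => ?_
      simp at hb
      simp [PowerSeries.coeff_one, hb]
    · intro t
      convert hasSum_single 0 ?_ using 1
      · simp
      · intro b hb
        simp [PowerSeries.coeff_one, hb]
  | succ N ih =>
    have hN := coeff_pow_nonneg hq N
    have h1 : Summable (fun s => PowerSeries.coeff s (PowerSeries.mk q ^ (N + 1))) := by
      have := summable_norm_sum_mul_antidiagonal_of_summable_norm ih.1.norm hs.norm
      refine this.of_norm.congr fun s => ?_
      rw [pow_succ, PowerSeries.coeff_mul]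
      simp
    refine ⟨h1, fun t => ?_⟩
    have h2 : natCharFun q t ^ (N + 1) =
        ∑' s, ((PowerSeries.coeff s (PowerSeries.mk q ^ (N + 1)) : ℝ) : ℂ) *
          Complex.exp (s * t * Complex.I) := by
      rw [pow_succ, ← (ih.2 t).tsum_eq, natCharFun,
        tsum_mul_tsum_eq_tsum_sum_antidiagonal_of_summable_norm
          (summable_mul_exp hN ih.1 t).norm (summable_mul_exp hq hs t).norm]
      refine tsum_congr fun s => ?_
      rw [pow_succ, PowerSeries.coeff_mul, Complex.ofReal_sum, Finset.sum_mul]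
      refine Finset.sum_congr rfl fun x hx => ?_
      have hx := Finset.HasAntidiagonal.mem_antidiagonal.1 hx
      rw [← hx, Nat.cast_add, add_mul, add_mul, Complex.exp_add, PowerSeries.coeff_mk]
      push_cast
      ring
    rw [h2]
    exact (summable_mul_exp (coeff_pow_nonneg hq (N + 1)) h1 t).hasSum

lemma dvd_of_coeff_pow_ne_zero {R : Type*} [CommSemiring R] {q : ℕ → R} {d : ℕ}
    (hd : ∀ k, q k ≠ 0 → d ∣ k) (N s : ℕ) (h : PowerSeries.coeff s (PowerSeries.mk q ^ N) ≠ 0) :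
    d ∣ s := by
  induction N generalizing s with
  | zero =>
    rw [pow_zero, PowerSeries.coeff_one] at h
    have : s = 0 := by
      by_contra h0
      simp [h0] at h
    simp [this]
  | succ N ih =>
    rw [pow_succ, PowerSeries.coeff_mul] at h
    obtain ⟨x, hx, hne⟩ := Finset.exists_ne_zero_of_sum_ne_zero h
    rw [← Finset.HasAntidiagonal.mem_antidiagonal.1 hx]
    refine dvd_add (ih _ (left_ne_zero_of_mul hne)) (hd _ ?_)
    simpa using right_ne_zero_of_mul hne

lemma integral_exp_int_mul (d : ℕ) (hd : 0 < d) (z : ℤ) :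
    ∫ t in (-(π / d))..(π / d), Complex.exp (((d * z : ℤ) : ℂ) * t * Complex.I) =
      if z = 0 then ((2 * π / d : ℝ) : ℂ) else 0 := by
  have hd' : (d : ℂ) ≠ 0 := by exact_mod_cast hd.ne'
  split_ifs with h
  · simp [h]
    ring
  · have hc : (((d * z : ℤ) : ℂ) * Complex.I) ≠ 0 := by
      simp [h, hd']
    have h1 : ∀ t : ℝ, (((d * z : ℤ) : ℂ) * t * Complex.I) = (((d * z : ℤ) : ℂ) * Complex.I) * t :=
      fun t => by ring
    simp_rw [h1]
    rw [integral_exp_mul_complex hc, div_eq_zero_iff, sub_eq_zero]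
    left
    rw [Complex.exp_eq_exp_iff_exists_int]
    refine ⟨z, ?_⟩
    push_cast
    field_simp
    ring

/-- Fourier inversion on a lattice. -/
lemma coeff_pow_eq_integral {q : ℕ → ℝ} (hq : ∀ k, 0 ≤ q k) (hs : Summable q) {d : ℕ} (hd : 0 < d)
    (hdq : ∀ k, q k ≠ 0 → d ∣ k) (N s : ℕ) (hds : d ∣ s) :
    ((2 * π / d : ℝ) : ℂ) * (PowerSeries.coeff s (PowerSeries.mk q ^ N) : ℝ) =
      ∫ t in (-(π / d))..(π / d), natCharFun q t ^ N * Complex.exp (-(s * t * Complex.I)) := by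
  obtain ⟨h1, h2⟩ := hasSum_coeff_pow hq hs N
  have h3 := intervalIntegral.hasSum_integral_of_dominated_convergence
    (μ := volume) (a := -(π / d)) (b := π / d)
    (F := fun k t => ((PowerSeries.coeff k (PowerSeries.mk q ^ N) : ℝ) : ℂ) *
        Complex.exp (k * t * Complex.I) * Complex.exp (-(s * t * Complex.I)))
    (f := fun t => natCharFun q t ^ N * Complex.exp (-(s * t * Complex.I)))
    (fun k _ => PowerSeries.coeff k (PowerSeries.mk q ^ N))
    (fun k => by
      refine Continuous.aestronglyMeasurable ?_
      fun_prop)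
    (fun k => by
      refine ae_of_all _ fun t _ => ?_
      rw [norm_mul, norm_mul_exp _ (coeff_pow_nonneg hq N), Complex.exp_neg, norm_inv,
        norm_exp_natCast_mul_I, inv_one, mul_one])
    (ae_of_all _ fun t _ => h1) (by simp)
    (ae_of_all _ fun t _ => (h2 t).mul_right _)
  refine HasSum.unique ?_ h3
  have h4 : ∀ k, ∫ t in (-(π / d))..(π / d),
      ((PowerSeries.coeff k (PowerSeries.mk q ^ N) : ℝ) : ℂ) *
        Complex.exp (k * t * Complex.I) * Complex.exp (-(s * t * Complex.I)) =
      if k = s then ((2 * π / d : ℝ) : ℂ) * (PowerSeries.coeff s (PowerSeries.mk q ^ N) : ℝ)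
        else 0 := by
    intro k
    by_cases hk : PowerSeries.coeff k (PowerSeries.mk q ^ N) = 0
    · rw [hk]
      split_ifs with hks
      · rw [← hks, hk]; simp
      · simp
    · obtain ⟨a, rfl⟩ := dvd_of_coeff_pow_ne_zero hdq N k hk
      obtain ⟨b, rfl⟩ := hds
      simp_rw [mul_assoc, intervalIntegral.integral_const_mul, ← Complex.exp_add]
      have h5 : ∀ t : ℝ, (((d * a : ℕ) : ℂ) * (t * Complex.I) +
          -(((d * b : ℕ) : ℂ) * (t * Complex.I)))
          = (((d * ((a : ℤ) - b) : ℤ) : ℂ) * t * Complex.I) := by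
        intro t; push_cast; ring
      simp_rw [h5]
      rw [integral_exp_int_mul d hd]
      by_cases hab : a = b
      · simp [hab]; ring
      · have : (a : ℤ) - b ≠ 0 := by omega
        have h6 : d * a ≠ d * b := fun h => hab (Nat.eq_of_mul_eq_mul_left hd h)
        simp [this, hab, hd.ne']
  simp_rw [h4]
  exact hasSum_ite_eq s _

lemma norm_natCharFun_le {q : ℕ → ℝ} (hq : ∀ k, 0 ≤ q k) (hs : HasSum q 1) {k : ℕ} (hk : 0 < k)
    (t : ℝ) : ‖natCharFun q t‖ ≤ 1 - q 0 * q k * (1 - Real.cos (k * t)) := by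
  have hsm := summable_mul_exp hq hs.summable t
  have h1 := hsm.sum_add_tsum_compl (s := {0, k})
  have h2 := hs.summable.sum_add_tsum_compl (s := {0, k})
  rw [Finset.sum_pair hk.ne] at h1 h2
  rw [hs.tsum_eq] at h2
  have h3 : ‖∑' x : ↑((({0, k} : Finset ℕ) : Set ℕ)ᶜ),
      (q x : ℂ) * Complex.exp ((x : ℕ) * t * Complex.I)‖ ≤
      ∑' x : ↑((({0, k} : Finset ℕ) : Set ℕ)ᶜ), q x := by
    refine (norm_tsum_le_tsum_norm ?_).trans ?_
    · simp_rw [norm_mul_exp q hq]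
      exact hs.summable.subtype _
    · simp_rw [norm_mul_exp q hq]
      exact le_rfl
  have h0 := hq 0
  have h0k := hq k
  have htail : 0 ≤ ∑' x : ↑((({0, k} : Finset ℕ) : Set ℕ)ᶜ), q x := tsum_nonneg fun x => hq x
  have hc1 := Real.cos_le_one (k * t)
  have hc2 := Real.neg_one_le_cos (k * t)
  have h4 : ‖(q 0 : ℂ) * Complex.exp ((0 : ℕ) * t * Complex.I) +
      q k * Complex.exp (k * t * Complex.I)‖ ≤
      q 0 + q k - q 0 * q k * (1 - Real.cos (k * t)) := by
    have hx : q 0 * q k ≤ q 0 := by nlinarith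
    have hx2 : q 0 * q k ≤ q k := by nlinarith
    refine le_of_sq_le_sq ?_ (by nlinarith [mul_nonneg h0 h0k])
    have e : (k * t * Complex.I : ℂ) = ((k * t : ℝ) : ℂ) * Complex.I := by push_cast; ring
    rw [e, Nat.cast_zero, zero_mul, zero_mul, Complex.exp_zero, mul_one, Complex.exp_mul_I,
      ← Complex.ofReal_cos, ← Complex.ofReal_sin, ← Complex.normSq_eq_norm_sq]
    generalize hs' : Real.sin (k * t) = s
    have hcs : s ^ 2 + Real.cos (k * t) ^ 2 = 1 := hs' ▸ Real.sin_sq_add_cos_sq _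
    generalize Real.cos (k * t) = c at *
    simp only [Complex.normSq_apply, Complex.add_re, Complex.add_im, Complex.mul_re,
      Complex.mul_im, Complex.ofReal_re, Complex.ofReal_im, Complex.I_re, Complex.I_im]
    have hA : 0 ≤ q 0 * q k * (1 - c) := mul_nonneg (mul_nonneg h0 h0k) (by linarith)
    have hB := mul_nonneg hA (show 0 ≤ 1 - q 0 - q k by linarith)
    have hC := sq_nonneg (q 0 * q k * (1 - c))
    linear_combination 2 * hB + hC + q k ^ 2 * hcs
  rw [natCharFun, ← h1]
  refine (norm_add_le _ _).trans ?_
  linarith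

/-- The span of a distribution with an atom at `0`. -/
lemma exists_span {q : ℕ → ℝ} {k₀ : ℕ} (hk₀ : 0 < k₀) (hqk : q k₀ ≠ 0) :
    ∃ d : ℕ, 0 < d ∧ (∀ k, q k ≠ 0 → d ∣ k) ∧
      ∀ t : ℝ, |t| ≤ π / d → (∀ k : ℕ, q k ≠ 0 → Real.cos (k * t) = 1) → t = 0 := by
  obtain ⟨g, hg⟩ := Int.subgroup_cyclic (AddSubgroup.closure {z : ℤ | ∃ k : ℕ, q k ≠ 0 ∧ z = k})
  have hdvd : ∀ k, q k ≠ 0 → g.natAbs ∣ k := by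
    intro k hk
    have h1 : (k : ℤ) ∈ AddSubgroup.closure {g} := by
      rw [← hg]
      exact AddSubgroup.subset_closure ⟨k, hk, rfl⟩
    rw [← AddSubgroup.zmultiples_eq_closure, Int.mem_zmultiples_iff] at h1
    exact Int.natAbs_dvd_natAbs.2 h1
  have hpos : 0 < g.natAbs := Nat.pos_of_dvd_of_pos (hdvd k₀ hqk) hk₀
  refine ⟨g.natAbs, hpos, hdvd, fun t ht hcos => ?_⟩
  have h2 : g ∈ AddSubgroup.closure {z : ℤ | ∃ k : ℕ, q k ≠ 0 ∧ z = k} := by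
    rw [hg]; exact AddSubgroup.subset_closure rfl
  have h3 : ∃ n : ℤ, (n : ℝ) * (2 * π) = g * t := by
    refine AddSubgroup.closure_induction
      (p := fun (z : ℤ) _ => ∃ n : ℤ, (n : ℝ) * (2 * π) = (z : ℝ) * t)
      ?_ ?_ ?_ ?_ h2
    · rintro z ⟨k, hk, rfl⟩
      simpa using (Real.cos_eq_one_iff _).1 (hcos k hk)
    · exact ⟨0, by simp⟩
    · rintro x y _ _ ⟨n, hn⟩ ⟨m, hm⟩
      exact ⟨n + m, by push_cast; linarith⟩
    · rintro x _ ⟨n, hn⟩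
      exact ⟨-n, by push_cast; linarith⟩
  obtain ⟨n, hn⟩ := h3
  have hgR : (0 : ℝ) < |(g : ℝ)| := by
    rw [abs_pos]
    exact_mod_cast Int.natAbs_pos.1 hpos
  have hcast : ((g.natAbs : ℕ) : ℝ) = |(g : ℝ)| := by
    rw [Nat.cast_natAbs]; push_cast; rfl
  rw [hcast, le_div_iff₀ hgR] at ht
  have h4 : |(n : ℝ)| * (2 * π) ≤ π := by
    have : |(n : ℝ) * (2 * π)| = |(g : ℝ)| * |t| := by rw [hn, abs_mul]
    rw [abs_mul, abs_of_pos (show (0 : ℝ) < 2 * π by positivity)] at this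
    rw [this, mul_comm]; exact ht
  have h5 : n = 0 := by
    by_contra hne
    have : (1 : ℝ) ≤ |(n : ℝ)| := by exact_mod_cast Int.one_le_abs hne
    nlinarith [Real.pi_pos]
  rw [h5] at hn
  have hg0 : (g : ℝ) ≠ 0 := abs_pos.1 hgR
  have : (g : ℝ) * t = 0 := by rw [← hn]; simp
  exact (mul_eq_zero.1 this).resolve_left hg0

lemma exists_norm_natCharFun_le_exp {q : ℕ → ℝ} (hq : ∀ k, 0 ≤ q k) (hs : HasSum q 1)
    (hq0 : q 0 ≠ 0) {k₀ : ℕ} (hk₀ : 0 < k₀) (hqk : q k₀ ≠ 0) {d : ℕ} (hd : 0 < d)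
    (hspan : ∀ t : ℝ, |t| ≤ π / d → (∀ k : ℕ, q k ≠ 0 → Real.cos (k * t) = 1) → t = 0) :
    ∃ c > 0, ∀ t : ℝ, |t| ≤ π / d → ‖natCharFun q t‖ ≤ Real.exp (-(c * t ^ 2)) := by
  have hq0' : 0 < q 0 := lt_of_le_of_ne (hq 0) hq0.symm
  have hqk' : 0 < q k₀ := lt_of_le_of_ne (hq k₀) hqk.symm
  have hk₀R : (0 : ℝ) < k₀ := by exact_mod_cast hk₀
  have hdR : (0 : ℝ) < d := by exact_mod_cast hd
  have hpi := Real.pi_pos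
  have hlt : ∀ t : ℝ, |t| ≤ π / d → t ≠ 0 → ‖natCharFun q t‖ < 1 := by
    intro t ht hne
    by_contra hge
    refine hne (hspan t ht fun k hk => ?_)
    rcases Nat.eq_zero_or_pos k with rfl | hkpos
    · simp
    · have h1 := norm_natCharFun_le hq hs hkpos t
      have h2 : 0 < q 0 * q k := mul_pos hq0' (lt_of_le_of_ne (hq k) hk.symm)
      have h3 := Real.cos_le_one (k * t)
      by_contra hc
      have h4 : 0 < 1 - Real.cos (k * t) := by
        have := lt_of_le_of_ne h3 hc
        linarith
      have := mul_pos h2 h4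
      linarith
  obtain ⟨ρ, hρ1, hρ⟩ : ∃ ρ < 1, ∀ t : ℝ, |t| ≤ π / d → π / k₀ ≤ |t| → ‖natCharFun q t‖ ≤ ρ := by
    let K : Set ℝ := {t | |t| ≤ π / d ∧ π / k₀ ≤ |t|}
    have hK : IsCompact K := by
      refine Metric.isCompact_of_isClosed_isBounded ?_ ?_
      · exact (isClosed_le continuous_abs continuous_const).inter
          (isClosed_le continuous_const continuous_abs)
      · refine (Metric.isBounded_closedBall (x := (0 : ℝ)) (r := π / d)).subset fun t ht => ?_
        simpa using ht.1
    rcases K.eq_empty_or_nonempty with he | hne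
    · refine ⟨0, one_pos, fun t h1 h2 => ?_⟩
      have : t ∈ K := ⟨h1, h2⟩
      rw [he] at this
      exact absurd this (notMem_empty _)
    · obtain ⟨x, hx, hmax⟩ := hK.exists_isMaxOn hne
        (continuous_natCharFun hq hs.summable).norm.continuousOn
      refine ⟨_, hlt x hx.1 ?_, fun t h1 h2 => hmax ⟨h1, h2⟩⟩
      rintro rfl
      have := hx.2
      rw [abs_zero] at this
      have : 0 < π / k₀ := by positivity
      linarith
  let c₁ := q 0 * q k₀ * (2 / π ^ 2 * (k₀ : ℝ) ^ 2)
  let c₂ := (1 - ρ) * ((d : ℝ) / π) ^ 2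
  have hc₁ : 0 < c₁ := by positivity
  have hc₂ : 0 < c₂ := mul_pos (by linarith) (by positivity)
  refine ⟨min c₁ c₂, lt_min hc₁ hc₂, fun t ht => ?_⟩
  suffices h : ‖natCharFun q t‖ ≤ 1 - min c₁ c₂ * t ^ 2 by
    refine h.trans ?_
    have := Real.add_one_le_exp (-(min c₁ c₂ * t ^ 2))
    linarith
  by_cases htk : π / k₀ ≤ |t|
  · have h1 := hρ t ht htk
    have h2 : min c₁ c₂ * t ^ 2 ≤ c₂ * (π / d) ^ 2 := by
      have : t ^ 2 ≤ (π / d) ^ 2 := by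
        rw [← sq_abs]; gcongr
      gcongr
      exact min_le_right _ _
    have h3 : c₂ * (π / d) ^ 2 = 1 - ρ := by
      simp only [c₂]; field_simp
    linarith
  · have h1 := norm_natCharFun_le hq hs hk₀ t
    have h2 : |(k₀ : ℝ) * t| ≤ π := by
      rw [abs_mul, abs_of_pos hk₀R, mul_comm]
      rw [not_le, lt_div_iff₀ hk₀R] at htk
      exact htk.le
    have h3 := Real.cos_le_one_sub_mul_cos_sq h2
    have h4 : min c₁ c₂ * t ^ 2 ≤ c₁ * t ^ 2 := by
      gcongr; exact min_le_left _ _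
    have h5 : c₁ * t ^ 2 = q 0 * q k₀ * (2 / π ^ 2 * (k₀ * t) ^ 2) := by
      simp only [c₁]; ring
    have h6 : q 0 * q k₀ * (2 / π ^ 2 * (k₀ * t) ^ 2) ≤ q 0 * q k₀ * (1 - Real.cos (k₀ * t)) := by
      gcongr; linarith
    linarith

lemma norm_pow_mul_exp_le {q : ℕ → ℝ} {c t : ℝ}
    (h : ‖natCharFun q t‖ ≤ Real.exp (-(c * t ^ 2))) (N s : ℕ) :
    ‖natCharFun q t ^ N * Complex.exp (-(s * t * Complex.I))‖ ≤ Real.exp (-(c * N) * t ^ 2) := by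
  rw [norm_mul, Complex.exp_neg, norm_inv, norm_exp_natCast_mul_I, inv_one, mul_one, norm_pow]
  refine (pow_le_pow_left₀ (norm_nonneg _) h N).trans_eq ?_
  rw [← Real.exp_nat_mul]
  congr 1
  ring

/-- Uniform bound on the point probabilities of a random walk. -/
lemma exists_coeff_pow_le {q : ℕ → ℝ} (hq : ∀ k, 0 ≤ q k) (hs : HasSum q 1)
    (hq0 : q 0 ≠ 0) {k₀ : ℕ} (hk₀ : 0 < k₀) (hqk : q k₀ ≠ 0) :
    ∃ C > 0, ∀ N s : ℕ, 0 < N → PowerSeries.coeff s (PowerSeries.mk q ^ N) ≤ C / √N := by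
  obtain ⟨d, hd, hdq, hspan⟩ := exists_span hk₀ hqk
  obtain ⟨c, hc, hle⟩ := exists_norm_natCharFun_le_exp hq hs hq0 hk₀ hqk hd hspan
  have hdR : (0 : ℝ) < d := by exact_mod_cast hd
  have hpi := Real.pi_pos
  refine ⟨√(π / c) / (2 * π / d), by positivity, fun N s hN => ?_⟩
  have hNR : (0 : ℝ) < N := by exact_mod_cast hN
  by_cases hds : d ∣ s
  · have h1 := coeff_pow_eq_integral hq hs.summable hd hdq N s hds
    have h2 := congrArg norm h1
    rw [norm_mul, Complex.norm_real, Complex.norm_real,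
      Real.norm_of_nonneg (coeff_pow_nonneg hq N s), Real.norm_of_nonneg (by positivity)] at h2
    have hint : Integrable fun t : ℝ => Real.exp (-(c * N) * t ^ 2) :=
      integrable_exp_neg_mul_sq (by positivity)
    have hab : -(π / d) ≤ π / d := by
      have : 0 < π / d := by positivity
      linarith
    have h3 : ‖∫ t in (-(π / d))..(π / d), natCharFun q t ^ N *
        Complex.exp (-(s * t * Complex.I))‖ ≤ √(π / (c * N)) := by
      refine (intervalIntegral.norm_integral_le_of_norm_le hab
        (g := fun t : ℝ => Real.exp (-(c * N) * t ^ 2)) ?_ hint.intervalIntegrable).trans ?_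
      · exact ae_of_all _ fun t ht => norm_pow_mul_exp_le (hle t (abs_le.2 ⟨ht.1.le, ht.2⟩)) N s
      · rw [← integral_gaussian, intervalIntegral.integral_of_le hab]
        exact setIntegral_le_integral hint (ae_of_all _ fun t => (Real.exp_pos _).le)
    rw [← h2] at h3
    rw [div_div, le_div_iff₀ (by positivity)]
    have h4 : √(π / (c * N)) = √(π / c) / √N := by
      rw [← div_div, Real.sqrt_div (by positivity)]
    rw [h4, le_div_iff₀ (by positivity)] at h3
    linarith
  · have : PowerSeries.coeff s (PowerSeries.mk q ^ N) = 0 := by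
      by_contra h
      exact hds (dvd_of_coeff_pow_ne_zero hdq N s h)
    rw [this]
    positivity

/-- The central limit theorem for the characteristic function of a distribution on `ℕ` with
mean one. -/
lemma tendsto_natCharFun_pow {q : ℕ → ℝ} (hq : ∀ k, 0 ≤ q k) (hs : HasSum q 1)
    (hmean : HasSum (fun k => k * q k) 1) {v : ℝ} (hv : 0 < v)
    (hvar : HasSum (fun k => q k * ((k : ℝ) - 1) ^ 2) v) (u : ℝ) :
    Tendsto (fun n : ℕ => natCharFun q (u / √n) ^ n *
        Complex.exp (-((n - 1 : ℕ) * (u / √n : ℝ) * Complex.I))) atTop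
      (𝓝 (Complex.exp (-(v / 2) * u ^ 2))) := by
  let P : Measure ℕ := Measure.sum fun k => ENNReal.ofReal (q k) • Measure.dirac k
  have hP : IsProbabilityMeasure P := hs.isProbabilityMeasure_sum_dirac hq
  have hint : ∀ {E : Type} [NormedAddCommGroup E] [NormedSpace ℝ E] [FiniteDimensional ℝ E]
      (f : ℕ → E), ∫ k, f k ∂P = ∑' k, q k • f k := by
    intro E _ _ _ f
    rw [integral_sum_dirac (by simp)]
    simp_rw [ENNReal.toReal_ofReal (hq _)]
  let X : ℕ → ℝ := fun k => ((k : ℝ) - 1) / √v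
  have hX0 : ∫ k, X k ∂P = 0 := by
    rw [hint]
    have := ((hmean.sub hs).div_const √v).tsum_eq
    rw [sub_self, zero_div] at this
    rw [← this]
    refine tsum_congr fun k => ?_
    simp only [X, smul_eq_mul]
    ring
  have hX1 : ∫ k, (X ^ 2) k ∂P = 1 := by
    rw [hint]
    have := (hvar.div_const v).tsum_eq
    rw [div_self hv.ne'] at this
    rw [← this]
    refine tsum_congr fun k => ?_
    simp only [X, smul_eq_mul, Pi.pow_apply, div_pow, Real.sq_sqrt hv.le]
    ring
  have hmeas : AEMeasurable X P := (measurable_of_countable X).aemeasurable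
  have h := ProbabilityTheory.tendsto_charFun_inv_sqrt_mul_pow hmeas hX0 hX1 (u * √v)
  have hchar : ∀ n : ℕ, charFun (P.map X) ((√n)⁻¹ * (u * √v)) =
      natCharFun q (u / √n) * Complex.exp (-((u / √n : ℝ) * Complex.I)) := by
    intro n
    rw [charFun_apply_real, integral_map hmeas (by fun_prop), hint, natCharFun, ← tsum_mul_right]
    refine tsum_congr fun k => ?_
    rw [Complex.real_smul, mul_assoc (q k : ℂ), ← Complex.exp_add]
    congr 2
    have : (√v : ℂ) ≠ 0 := by
      exact_mod_cast (Real.sqrt_pos.2 hv).ne'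
    simp only [X]
    push_cast
    field_simp
    ring
  have hlast : Tendsto (fun n : ℕ => Complex.exp ((u / √n : ℝ) * Complex.I)) atTop (𝓝 1) := by
    have h0 : Tendsto (fun n : ℕ => u / √(n : ℝ)) atTop (𝓝 0) :=
      tendsto_const_nhds.div_atTop (Real.tendsto_sqrt_atTop.comp tendsto_natCast_atTop_atTop)
    have hcont : Continuous fun x : ℝ => Complex.exp (x * Complex.I) := by fun_prop
    simpa [Function.comp_def] using (hcont.tendsto 0).comp h0
  have h' := h.mul hlast
  rw [mul_one] at h'
  have e : Complex.exp (-(v / 2) * u ^ 2) = Complex.exp (-((u * √v : ℝ) : ℂ) ^ 2 / 2) := by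
    congr 1
    have : ((√v : ℝ) : ℂ) ^ 2 = v := by exact_mod_cast Real.sq_sqrt hv.le
    push_cast
    rw [mul_pow, this]
    ring
  rw [e]
  refine h'.congr' ?_
  filter_upwards [eventually_ge_atTop 1] with n hn
  rw [hchar, mul_pow, ← Complex.exp_nat_mul, mul_assoc, ← Complex.exp_add]
  congr 2
  push_cast [Nat.cast_sub hn]
  ring

/-- Lower bound in the local limit theorem at the mean. -/
lemma exists_le_coeff_pow {q : ℕ → ℝ} (hq : ∀ k, 0 ≤ q k) (hs : HasSum q 1)
    (hq0 : q 0 ≠ 0) {k₀ : ℕ} (hk₀ : 0 < k₀) (hqk : q k₀ ≠ 0)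
    (hmean : HasSum (fun k => k * q k) 1) {v : ℝ} (hv : 0 < v)
    (hvar : HasSum (fun k => q k * ((k : ℝ) - 1) ^ 2) v) :
    ∃ c > 0, ∃ n₀ : ℕ, ∀ n ≥ n₀, PowerSeries.coeff (n - 1) (PowerSeries.mk q ^ n) ≠ 0 →
      c / √n ≤ PowerSeries.coeff (n - 1) (PowerSeries.mk q ^ n) := by
  obtain ⟨d, hd, hdq, hspan⟩ := exists_span hk₀ hqk
  obtain ⟨c, hc, hle⟩ := exists_norm_natCharFun_le_exp hq hs hq0 hk₀ hqk hd hspan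
  have hdR : (0 : ℝ) < d := by exact_mod_cast hd
  have hpi := Real.pi_pos
  have ha : 0 < π / d := by positivity
  let f : ℕ → ℝ → ℂ := fun n t =>
    natCharFun q t ^ n * Complex.exp (-((n - 1 : ℕ) * t * Complex.I))
  let G : ℕ → ℝ → ℂ := fun n =>
    (Ioc (-(π / d * √n)) (π / d * √n)).indicator fun u => f n (u / √n)
  have hlim : Tendsto (fun n => ∫ u, G n u) atTop
      (𝓝 (∫ u : ℝ, Complex.exp (-(v / 2) * u ^ 2))) := by
    refine tendsto_integral_of_dominated_convergence (fun u => Real.exp (-c * u ^ 2)) ?_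
      (integrable_exp_neg_mul_sq hc) ?_ ?_
    · intro n
      refine AEStronglyMeasurable.indicator ?_ measurableSet_Ioc
      refine Continuous.aestronglyMeasurable ?_
      have := continuous_natCharFun hq hs.summable
      fun_prop
    · refine fun n => ae_of_all _ fun u => ?_
      simp only [G]
      rw [indicator_apply]
      split_ifs with hu
      · have hn : 0 < √(n : ℝ) := by
          rcases (Real.sqrt_nonneg (n : ℝ)).lt_or_eq with h | h
          · exact h
          · rw [← h] at hu
            have := hu.1.trans_le hu.2
            simp at this
        have h1 : |u / √n| ≤ π / d := by
          rw [abs_div, abs_of_pos hn, div_le_iff₀ hn]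
          exact abs_le.2 ⟨hu.1.le, hu.2⟩
        refine (norm_pow_mul_exp_le (hle _ h1) n (n - 1)).trans_eq ?_
        have hnn : (n : ℝ) ≠ 0 := (Real.sqrt_pos.1 hn).ne'
        rw [div_pow, Real.sq_sqrt (Nat.cast_nonneg n)]
        congr 1
        field_simp
      · rw [norm_zero]
        exact (Real.exp_pos _).le
    · refine ae_of_all _ fun u => ?_
      refine (tendsto_natCharFun_pow hq hs hmean hv hvar u).congr' ?_
      have h1 : Tendsto (fun n : ℕ => π / d * √(n : ℝ)) atTop atTop :=
        (Real.tendsto_sqrt_atTop.comp tendsto_natCast_atTop_atTop).const_mul_atTop ha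
      filter_upwards [h1.eventually_gt_atTop |u|] with n hn
      have : u ∈ Ioc (-(π / d * √n)) (π / d * √n) := ⟨(abs_lt.1 hn).1, (abs_lt.1 hn).2.le⟩
      simp only [G, f]
      rw [indicator_of_mem this]
  have hlim' : ∫ u : ℝ, Complex.exp (-(v / 2) * u ^ 2) = ((√(π / (v / 2)) : ℝ) : ℂ) := by
    rw [← integral_gaussian, ← integral_complex_ofReal]
    push_cast
    rfl
  rw [hlim'] at hlim
  have hI : 0 < √(π / (v / 2)) := by positivity
  have hev := (Complex.continuous_re.tendsto _).comp hlim
  rw [Complex.ofReal_re] at hev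
  obtain ⟨n₀, hn₀⟩ := eventually_atTop.1 (hev.eventually (lt_mem_nhds (half_lt_self hI)))
  refine ⟨√(π / (v / 2)) / 2 / (2 * π / d), by positivity, max n₀ 1, fun n hn hne => ?_⟩
  have hnn : 0 < √(n : ℝ) := by
    have : 1 ≤ n := (le_max_right _ _).trans hn
    exact Real.sqrt_pos.2 (by exact_mod_cast this)
  have h1 := coeff_pow_eq_integral hq hs.summable hd hdq n (n - 1)
    (dvd_of_coeff_pow_ne_zero hdq _ _ hne)
  have h2 : ∫ u, G n u = √n * ∫ t in (-(π / d))..(π / d), f n t := by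
    simp only [G]
    rw [integral_indicator measurableSet_Ioc, ← intervalIntegral.integral_of_le
      (by nlinarith [mul_pos ha hnn]), intervalIntegral.integral_comp_div _ hnn.ne', neg_div,
      mul_div_cancel_right₀ _ hnn.ne', Complex.real_smul]
  have h3 := hn₀ n ((le_max_left _ _).trans hn)
  simp only [Function.comp_apply, h2, f, ← h1] at h3
  rw [← Complex.ofReal_mul, ← Complex.ofReal_mul, Complex.ofReal_re] at h3
  rw [div_div, div_le_iff₀ (by positivity)]
  linarith

end LocalLimit

section Offspring

open PowerSeries

variable {p : ℕ → ℝ≥0∞}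

lemma ENNReal.hasSum_toReal_of_tsum_eq {f : ℕ → ℝ≥0∞} {a : ℝ≥0∞} (ha : a ≠ ⊤)
    (h : ∑' k, f k = a) : HasSum (fun k => (f k).toReal) a.toReal := by
  have hf : ∑' k, f k ≠ ⊤ := h ▸ ha
  rw [← h, ENNReal.tsum_toReal_eq fun k => ENNReal.ne_top_of_tsum_ne_top hf k]
  exact ENNReal.hasSum_toReal hf

lemma coeff_mk_pow_eq_ofReal (hp : ∀ k, p k ≠ ⊤) (N s : ℕ) :
    coeff s (PowerSeries.mk p ^ N) =
      ENNReal.ofReal (coeff s (PowerSeries.mk (fun k => (p k).toReal) ^ N)) := by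
  have hq : ∀ k, 0 ≤ (p k).toReal := fun k => ENNReal.toReal_nonneg
  induction N generalizing s with
  | zero => rw [pow_zero, pow_zero, coeff_one, coeff_one]; split_ifs <;> simp
  | succ N ih =>
    rw [pow_succ, pow_succ, coeff_mul, coeff_mul, ENNReal.ofReal_sum_of_nonneg]
    · refine Finset.sum_congr rfl fun x _ => ?_
      rw [ENNReal.ofReal_mul (coeff_pow_nonneg hq N _), ih, coeff_mk, coeff_mk,
        ENNReal.ofReal_toReal (hp _)]
    · intro x _
      exact mul_nonneg (coeff_pow_nonneg hq N _) (by rw [coeff_mk]; exact hq _)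

lemma evalAt_one (c : ℝ≥0∞⟦X⟧) : evalAt 1 c = ∑' i, coeff i c := by
  simp [evalAt]

lemma sum_range_coeff_le_evalAt_one (c : ℝ≥0∞⟦X⟧) (N : ℕ) :
    ∑ i ∈ Finset.range N, coeff i c ≤ evalAt 1 c := by
  rw [evalAt_one]
  exact ENNReal.sum_le_tsum _

lemma sum_range_coeff_le_two_pow_mul (c : ℝ≥0∞⟦X⟧) (N : ℕ) :
    ∑ i ∈ Finset.range N, coeff i c ≤ 2 ^ N * evalAt 2⁻¹ c := by
  refine le_trans ?_ (mul_le_mul_right (ENNReal.sum_le_tsum (Finset.range N)) _)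
  rw [Finset.mul_sum]
  refine Finset.sum_le_sum fun i hi => ?_
  have hi := (Finset.mem_range.1 hi).le
  have h : (2 : ℝ≥0∞) ^ N * 2⁻¹ ^ i = 2 ^ (N - i) := by
    rw [← Nat.sub_add_cancel hi, pow_add, mul_assoc, ← mul_pow,
      ENNReal.mul_inv_cancel (by norm_num) (by norm_num), one_pow, mul_one, Nat.add_sub_cancel]
  rw [mul_left_comm, h]
  exact le_mul_of_one_le_right zero_le (one_le_pow₀ (by norm_num))

lemma evalAt_one_derivative (hmean : ∑' k : ℕ, (k : ℝ≥0∞) * p k = 1) :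
    evalAt 1 (derivative ℝ≥0∞ (PowerSeries.mk p)) = 1 := by
  rw [evalAt_one, ← hmean, tsum_eq_zero_add' (f := fun k : ℕ => (k : ℝ≥0∞) * p k) ENNReal.summable]
  simp [coeff_derivative, mul_comm]

lemma evalAt_half_derivative_lt_one (hmean : ∑' k : ℕ, (k : ℝ≥0∞) * p k = 1) (h1 : p 1 < 1) :
    evalAt 2⁻¹ (derivative ℝ≥0∞ (PowerSeries.mk p)) < 1 := by
  set c := derivative ℝ≥0∞ (PowerSeries.mk p)
  have h0 : coeff 0 c = p 1 := by simp [c, coeff_derivative]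
  have hsum : coeff 0 c + ∑' i, coeff (i + 1) c = 1 := by
    rw [← evalAt_one_derivative hmean, evalAt_one]
    exact (tsum_eq_zero_add' (f := fun i => coeff i c) ENNReal.summable).symm
  have hle : evalAt 2⁻¹ c ≤ coeff 0 c + (∑' i, coeff (i + 1) c) / 2 := by
    rw [evalAt, tsum_eq_zero_add' ENNReal.summable, pow_zero, mul_one, ENNReal.div_eq_inv_mul,
      ← ENNReal.tsum_mul_left]
    refine add_le_add_right (ENNReal.tsum_le_tsum fun i => ?_) _
    rw [mul_comm, pow_succ]
    refine mul_le_mul_left ?_ _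
    exact mul_le_of_le_one_left zero_le (pow_le_one₀ zero_le (by simp))
  refine hle.trans_lt ?_
  have hfin : ∑' i, coeff (i + 1) c ≠ ⊤ := by
    intro h
    rw [h] at hsum
    simp at hsum
  have hne : ∑' i, coeff (i + 1) c ≠ 0 := by
    intro h
    rw [h, add_zero, h0] at hsum
    exact h1.ne hsum
  have := ENNReal.add_lt_add_left (a := coeff 0 c) (by rw [h0]; exact h1.ne_top)
    (ENNReal.half_lt_self hne hfin)
  rwa [hsum] at this

lemma evalAt_one_derivative_derivative_le :
    evalAt 1 (derivative ℝ≥0∞ (derivative ℝ≥0∞ (PowerSeries.mk p))) ≤ 2 * xiVar p := by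
  calc evalAt 1 (derivative ℝ≥0∞ (derivative ℝ≥0∞ (PowerSeries.mk p)))
      ≤ ∑' k : ℕ, 2 * (p (k + 2) * ENNReal.ofReal ((((k + 2 : ℕ) : ℝ) - 1) ^ 2)) := by
        rw [evalAt_one]
        refine ENNReal.tsum_le_tsum fun k => ?_
        have h : ENNReal.ofReal ((((k + 2 : ℕ) : ℝ) - 1) ^ 2) = ((k + 1 : ℕ) : ℝ≥0∞) ^ 2 := by
          rw [← ENNReal.ofReal_natCast, ← ENNReal.ofReal_pow (by positivity)]
          congr 2
          push_cast
          ring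
        rw [h, coeff_derivative, coeff_derivative, coeff_mk, mul_assoc, mul_left_comm 2]
        refine mul_le_mul_right (α := ℝ≥0∞) ?_ _
        have : (k + 1 + 1) * (k + 1) ≤ 2 * (k + 1) ^ 2 := by nlinarith
        exact_mod_cast this
    _ ≤ 2 * xiVar p := by
        rw [ENNReal.tsum_mul_left, xiVar]
        refine mul_le_mul_right ?_ _
        exact ENNReal.tsum_comp_le_tsum_of_injective (add_left_injective 2)
          fun k : ℕ => p k * ENNReal.ofReal (((k : ℝ) - 1) ^ 2)

lemma evalAt_mono_left {x y : ℝ≥0∞} (h : x ≤ y) (c : ℝ≥0∞⟦X⟧) : evalAt x c ≤ evalAt y c :=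
  ENNReal.tsum_le_tsum fun i => mul_le_mul_right (pow_le_pow_left₀ zero_le h i) _

lemma evalAt_pathSeries_le {x : ℝ≥0∞} (hx : x ≤ 1) (k : ℕ) :
    evalAt x (PlaneTree.pathSeries p k) ≤
      2 * xiVar p * evalAt x (derivative ℝ≥0∞ (PowerSeries.mk p)) ^ k := by
  rw [PlaneTree.pathSeries, evalAt_mul, evalAt_mul, evalAt_X, evalAt_pow]
  refine mul_le_mul_left ?_ _
  calc x * evalAt x (derivative ℝ≥0∞ (derivative ℝ≥0∞ (PowerSeries.mk p)))
      ≤ 1 * evalAt 1 (derivative ℝ≥0∞ (derivative ℝ≥0∞ (PowerSeries.mk p))) :=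
        mul_le_mul' hx (evalAt_mono_left hx _)
    _ ≤ 2 * xiVar p := by
        rw [one_mul]
        exact evalAt_one_derivative_derivative_le

lemma coeff_mk_pow_le_one (hp : ∑' k, p k = 1) (N s : ℕ) :
    coeff s (PowerSeries.mk p ^ N) ≤ 1 := by
  have h : evalAt 1 (PowerSeries.mk p ^ N) = 1 := by
    rw [evalAt_pow, evalAt_one]
    simp [hp]
  rw [← h, evalAt_one]
  exact ENNReal.le_tsum s

/-- An offspring law with mean one and positive variance charges zero. -/
lemma zero_mem_support_of_mean_eq_one {q : ℕ → ℝ} (hq : ∀ k, 0 ≤ q k) (hs : HasSum q 1)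
    (hmean : HasSum (fun k => k * q k) 1) {v : ℝ} (hv : 0 < v)
    (hvar : HasSum (fun k => q k * ((k : ℝ) - 1) ^ 2) v) : q 0 ≠ 0 := by
  intro h0
  have h1 := hmean.sub hs
  rw [sub_self, hasSum_zero_iff_of_nonneg] at h1
  · have h2 : (fun k => q k * ((k : ℝ) - 1) ^ 2) = 0 := by
      funext k
      have := congrFun h1 k
      simp only [Pi.zero_apply] at this ⊢
      linear_combination ((k : ℝ) - 1) * this
    rw [h2] at hvar
    exact hv.ne' (hvar.unique hasSum_zero)
  · intro k
    rcases Nat.eq_zero_or_pos k with rfl | hk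
    · simp [h0]
    · have : (1 : ℝ) ≤ k := by exact_mod_cast hk
      nlinarith [hq k]

lemma exists_pos_mem_support_of_mean_eq_one {q : ℕ → ℝ} (hmean : HasSum (fun k => k * q k) 1) :
    ∃ k, 0 < k ∧ q k ≠ 0 := by
  by_contra! h
  have : (fun k : ℕ => (k : ℝ) * q k) = 0 := by
    funext k
    rcases Nat.eq_zero_or_pos k with rfl | hk
    · simp
    · simp [h k hk]
  rw [this] at hmean
  exact one_ne_zero (hmean.unique hasSum_zero)

/-- Interpolation between polynomial decay in `N` and exponential decay in `k`. -/
lemma exists_le_div_sqrt_of_le {ρ : ℝ} (h0 : 0 ≤ ρ) (h1 : ρ < 1) :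
    ∃ C > 0, ∀ (N k : ℕ) (a : ℝ), 0 < N → a ≤ 1 / √N → a ≤ 2 ^ N * ρ ^ k →
      a ≤ C / √(N + (k + 1) : ℕ) := by
  obtain ⟨M, hM⟩ := exists_pow_lt_of_lt_one (show (0 : ℝ) < 1 / 2 by norm_num) h1
  obtain ⟨B, hB⟩ := (tendsto_self_mul_const_pow_of_lt_one h0 h1).bddAbove_range
  have hB : ∀ m : ℕ, m * ρ ^ m ≤ B := fun m => hB ⟨m, rfl⟩
  have hB0 : 0 ≤ B := by simpa using hB 0
  refine ⟨√(2 * M + 2) + (4 * B + 1), by positivity, fun N k a hN ha hb => ?_⟩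
  have hNR : (1 : ℝ) ≤ N := by exact_mod_cast hN
  have hn : 0 < √((N + (k + 1) : ℕ) : ℝ) := Real.sqrt_pos.2 (by positivity)
  rw [le_div_iff₀ hn]
  by_cases hk : k ≤ 2 * M * N
  · have hkR : (k : ℝ) ≤ 2 * M * N := by exact_mod_cast hk
    have h2 : √((N + (k + 1) : ℕ) : ℝ) ≤ √(2 * M + 2) * √N := by
      rw [← Real.sqrt_mul (by positivity)]
      refine Real.sqrt_le_sqrt ?_
      push_cast
      linarith
    have hsN : 0 < √(N : ℝ) := Real.sqrt_pos.2 (by linarith)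
    calc a * √((N + (k + 1) : ℕ) : ℝ) ≤ 1 / √N * (√(2 * M + 2) * √N) := by gcongr
      _ = √(2 * M + 2) := by field_simp
      _ ≤ _ := by linarith
  · have hk : M * N ≤ k / 2 := by
      rw [Nat.le_div_iff_mul_le two_pos]
      linarith
    obtain ⟨m, hm⟩ : ∃ m, k = k / 2 + m := ⟨k - k / 2, by omega⟩
    have hM0 : 0 < M := by
      rcases Nat.eq_zero_or_pos M with rfl | h
      · norm_num at hM
      · exact h
    have hNk : N ≤ k := (Nat.le_mul_of_pos_left N hM0).trans (hk.trans (Nat.div_le_self k 2))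
    have h2 : (2 : ℝ) ^ N * ρ ^ (k / 2) ≤ 1 := by
      calc (2 : ℝ) ^ N * ρ ^ (k / 2) ≤ 2 ^ N * ρ ^ (M * N) := by
            gcongr 2 ^ N * ?_
            exact pow_le_pow_of_le_one h0 h1.le hk
        _ = (2 * ρ ^ M) ^ N := by rw [mul_pow, pow_mul]
        _ ≤ 1 := pow_le_one₀ (by positivity) (by linarith)
    have h3 : a ≤ ρ ^ m := by
      calc a ≤ 2 ^ N * ρ ^ k := hb
        _ = (2 ^ N * ρ ^ (k / 2)) * ρ ^ m := by rw [mul_assoc, ← pow_add, ← hm]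
        _ ≤ 1 * ρ ^ m := by gcongr
        _ = ρ ^ m := one_mul _
    have h4 : √((N + (k + 1) : ℕ) : ℝ) ≤ 4 * m + 1 := by
      rw [Real.sqrt_le_left (by positivity)]
      have : N + (k + 1) ≤ 4 * m + 1 := by omega
      have : ((N + (k + 1) : ℕ) : ℝ) ≤ 4 * m + 1 := by exact_mod_cast this
      nlinarith [(Nat.cast_nonneg m : (0 : ℝ) ≤ m)]
    have h5 : ρ ^ m ≤ 1 := pow_le_one₀ h0 h1.le
    have h6 : a * √((N + (k + 1) : ℕ) : ℝ) ≤ ρ ^ m * (4 * m + 1) := by gcongr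
    have := hB m
    have := Real.sqrt_nonneg (2 * (M : ℝ) + 2)
    linarith

end Offspring

namespace PlaneTree

open PowerSeries

lemma coeff_genFun_orderedPairCount_le_mul (p : ℕ → ℝ≥0∞) (l m N : ℕ) {b : ℝ≥0∞}
    (hb : ∀ s, coeff s (PowerSeries.mk p ^ N) ≤ b) :
    coeff (N + (l + m + 1)) (genFun p (fun t => (orderedPairCount t (l + 1) (m + 1) : ℝ≥0∞))) ≤
      (∑ i ∈ Finset.range N, coeff i (pathSeries p (l + m))) * b := by
  rw [coeff_genFun_orderedPairCount, Finset.sum_mul]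
  exact Finset.sum_le_sum fun i _ => mul_le_mul_right (hb _) _

/-- Upper bound for the unnormalised expectation of `orderedPairCount`. -/
lemma exists_coeff_genFun_orderedPairCount_le {p : ℕ → ℝ≥0∞} (hp : ∑' k, p k = 1)
    (hmean : ∑' k : ℕ, (k : ℝ≥0∞) * p k = 1) (hp1 : p 1 < 1)
    (hvar_pos : 0 < xiVar p) (hvar_fin : xiVar p ≠ ⊤) {A : ℝ} (hA : 0 < A)
    (hupper : ∀ N s : ℕ, 0 < N → coeff s (PowerSeries.mk p ^ N) ≤ ENNReal.ofReal (A / √N)) :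
    ∃ K > 0, ∀ l m n : ℕ,
      coeff n (genFun p (fun t => (orderedPairCount t (l + 1) (m + 1) : ℝ≥0∞))) ≤
        ENNReal.ofReal (K / √n) := by
  set r := evalAt 2⁻¹ (derivative ℝ≥0∞ (PowerSeries.mk p))
  have hr1 : r < 1 := evalAt_half_derivative_lt_one hmean hp1
  have hρ : r.toReal < 1 := by
    simpa using (ENNReal.toReal_lt_toReal hr1.ne_top ENNReal.one_ne_top).2 hr1
  obtain ⟨B, hB, hinter⟩ := exists_le_div_sqrt_of_le ENNReal.toReal_nonneg hρ
  set V := (2 * xiVar p).toReal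
  have hV0 : 0 < V := ENNReal.toReal_pos (mul_ne_zero two_ne_zero hvar_pos.ne')
    (ENNReal.mul_ne_top ENNReal.ofNat_ne_top hvar_fin)
  have hVe : 2 * xiVar p = ENNReal.ofReal V :=
    (ENNReal.ofReal_toReal (ENNReal.mul_ne_top ENNReal.ofNat_ne_top hvar_fin)).symm
  have hre : r = ENNReal.ofReal r.toReal := (ENNReal.ofReal_toReal hr1.ne_top).symm
  refine ⟨V * (A + 1) * B, by positivity, fun l m n => ?_⟩
  rcases lt_or_ge n (l + m + 1) with hn | hn
  · rw [coeff_genFun_orderedPairCount_of_lt p l m n hn]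
    exact zero_le
  obtain ⟨N, rfl⟩ := Nat.exists_eq_add_of_le' hn
  rcases Nat.eq_zero_or_pos N with rfl | hN
  · rw [coeff_genFun_orderedPairCount, Finset.range_zero, Finset.sum_empty]
    exact zero_le
  set a := coeff (N + (l + m + 1))
    (genFun p (fun t => (orderedPairCount t (l + 1) (m + 1) : ℝ≥0∞)))
  have h1 : a ≤ ENNReal.ofReal (V * (A / √N)) := by
    refine (coeff_genFun_orderedPairCount_le_mul p l m N fun s => hupper N s hN).trans ?_
    rw [ENNReal.ofReal_mul hV0.le, ← hVe]
    refine mul_le_mul_left ((sum_range_coeff_le_evalAt_one _ N).trans ?_) _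
    simpa [evalAt_one_derivative hmean] using evalAt_pathSeries_le (p := p) le_rfl (l + m)
  have h2 : a ≤ ENNReal.ofReal (V * (2 ^ N * r.toReal ^ (l + m))) := by
    refine (coeff_genFun_orderedPairCount_le_mul p l m N (coeff_mk_pow_le_one hp N)).trans ?_
    rw [mul_one, ENNReal.ofReal_mul hV0.le, ENNReal.ofReal_mul (by positivity),
      ENNReal.ofReal_pow ENNReal.toReal_nonneg, ← hre, ← hVe, ENNReal.ofReal_pow zero_le_two,
      ENNReal.ofReal_ofNat, mul_left_comm]
    exact (sum_range_coeff_le_two_pow_mul _ N).trans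
      (mul_le_mul_right (evalAt_pathSeries_le (by simp) (l + m)) _)
  have ha_top : a ≠ ⊤ := ne_top_of_le_ne_top ENNReal.ofReal_ne_top h1
  have h1' := ENNReal.toReal_le_of_le_ofReal (by positivity) h1
  have h2' := ENNReal.toReal_le_of_le_ofReal (by positivity) h2
  have h3 := hinter N (l + m) (a.toReal / (V * (A + 1))) hN
    (by
      rw [div_le_iff₀ (by positivity)]
      refine h1'.trans ?_
      have : V * (A / √N) = 1 / √N * (V * A) := by ring
      rw [this]
      gcongr
      linarith)
    (by
      rw [div_le_iff₀ (by positivity)]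
      refine h2'.trans ?_
      rw [mul_comm V]
      gcongr
      nlinarith)
  rw [div_le_iff₀ (by positivity)] at h3
  refine ENNReal.le_ofReal_iff_toReal_le ha_top (by positivity) |>.2 (h3.trans_eq ?_)
  ring

end PlaneTree

/-- Theorem 4 of Devroye–Janson.  There is a constant `C > 0` such that
`E Y_{ℓ,m}(T_n) ≤ C n` for all `ℓ, m ≥ 0` and `n ≥ 1`. -/
theorem expected_orderedPairCount_le
    (p : ℕ → ℝ≥0∞) (hp : ∑' k : ℕ, p k = 1)
    (hmean : ∑' k : ℕ, (k : ℝ≥0∞) * p k = 1)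
    (hvar_pos : 0 < xiVar p) (hvar_fin : xiVar p ≠ ⊤) :
    ∃ C : ℝ, 0 < C ∧ ∀ l m n : ℕ, 1 ≤ n → probSize p n ≠ 0 →
      condExp p n (fun t => (orderedPairCount t l m : ℝ≥0∞)) ≤ ENNReal.ofReal (C * n) := by
  have hpt : ∀ k, p k ≠ ⊤ := fun k => ENNReal.ne_top_of_tsum_ne_top (hp ▸ ENNReal.one_ne_top) k
  let q : ℕ → ℝ := fun k => (p k).toReal
  have hq : ∀ k, 0 ≤ q k := fun k => ENNReal.toReal_nonneg
  have hs : HasSum q 1 := ENNReal.hasSum_toReal_of_tsum_eq ENNReal.one_ne_top hp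
  have hqmean : HasSum (fun k => k * q k) 1 := by
    simpa [q] using ENNReal.hasSum_toReal_of_tsum_eq ENNReal.one_ne_top hmean
  have hv : 0 < (xiVar p).toReal := ENNReal.toReal_pos hvar_pos.ne' hvar_fin
  have hqvar : HasSum (fun k => q k * ((k : ℝ) - 1) ^ 2) (xiVar p).toReal := by
    have := ENNReal.hasSum_toReal_of_tsum_eq hvar_fin rfl
    simpa only [ENNReal.toReal_mul, ENNReal.toReal_ofReal (sq_nonneg _)] using this
  have hq0 := zero_mem_support_of_mean_eq_one hq hs hqmean hv hqvar
  obtain ⟨k₀, hk₀, hqk⟩ := exists_pos_mem_support_of_mean_eq_one hqmean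
  have hp1 : p 1 < 1 := by
    refine lt_of_le_of_ne (hp ▸ ENNReal.le_tsum 1) fun h => hq0 ?_
    have h1 : q 0 + q 1 ≤ 1 := by
      simpa [Finset.sum_range_succ] using sum_le_hasSum (Finset.range 2) (fun k _ => hq k) hs
    have h2 : q 1 = 1 := by simp [q, h]
    exact le_antisymm (by linarith) (hq 0)
  obtain ⟨A, hA, hupper⟩ := exists_coeff_pow_le hq hs hq0 hk₀ hqk
  obtain ⟨c, hc, n₀, hlower⟩ := exists_le_coeff_pow hq hs hq0 hk₀ hqk hqmean hv hqvar
  obtain ⟨K, hK, hbound⟩ := PlaneTree.exists_coeff_genFun_orderedPairCount_le hp hmean hp1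
    hvar_pos hvar_fin hA fun N s hN => by
      rw [coeff_mk_pow_eq_ofReal hpt]
      exact ENNReal.ofReal_le_ofReal (hupper N s hN)
  refine ⟨K / c + n₀ + 1, by positivity, fun l m n hn hprob => ?_⟩
  have hKc : 0 < K / c := by positivity
  have hnR : (1 : ℝ) ≤ n := by exact_mod_cast hn
  have htriv : ∀ {f : PlaneTree → ℕ}, (∀ t, f t ≤ PlaneTree.size t) →
      condExp p n (fun t => (f t : ℝ≥0∞)) ≤ ENNReal.ofReal ((K / c + n₀ + 1) * n) := by
    refine fun {f} hf => PlaneTree.condExp_le_of_le p fun t ht => ?_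
    rw [← ENNReal.ofReal_natCast]
    refine ENNReal.ofReal_le_ofReal ?_
    have h : (f t : ℝ) ≤ n := by exact_mod_cast ht ▸ hf t
    nlinarith [(Nat.cast_nonneg n₀ : (0 : ℝ) ≤ n₀)]
  rcases l with _ | l
  · exact htriv fun t => PlaneTree.orderedPairCount_zero_le t m
  rcases m with _ | m
  · exact htriv fun t => PlaneTree.orderedPairCount_swap t _ _ ▸
      PlaneTree.orderedPairCount_zero_le t _
  rcases lt_or_ge n n₀ with hlt | hge
  · refine PlaneTree.condExp_le_of_le p fun t ht => ?_
    rw [← ENNReal.ofReal_natCast]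
    refine ENNReal.ofReal_le_ofReal ?_
    have h : (orderedPairCount t (l + 1) (m + 1) : ℝ) ≤ n ^ 2 := by
      exact_mod_cast ht ▸ PlaneTree.orderedPairCount_le_sq t (l + 1) (m + 1)
    have hltR : (n : ℝ) ≤ n₀ := by exact_mod_cast hlt.le
    nlinarith
  · have hdwass : (n : ℝ≥0∞) * probSize p n =
        ENNReal.ofReal (PowerSeries.coeff (n - 1) (PowerSeries.mk q ^ n)) := by
      obtain ⟨n, rfl⟩ := Nat.exists_eq_add_of_le' hn
      rw [PlaneTree.mul_probSize, coeff_mk_pow_eq_ofReal hpt]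
      rfl
    have hne : PowerSeries.coeff (n - 1) (PowerSeries.mk q ^ n) ≠ 0 := by
      intro h
      rw [h, ENNReal.ofReal_zero] at hdwass
      refine mul_ne_zero ?_ hprob hdwass
      exact_mod_cast (Nat.one_le_iff_ne_zero.1 hn)
    rw [PlaneTree.condExp_eq]
    refine ENNReal.div_le_of_le_mul ((hbound l m n).trans ?_)
    calc ENNReal.ofReal (K / √n) = ENNReal.ofReal (K / c) * ENNReal.ofReal (c / √n) := by
          rw [← ENNReal.ofReal_mul hKc.le]
          congr 1
          field_simp
      _ ≤ ENNReal.ofReal (K / c + n₀ + 1) * (n * probSize p n) := by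
          rw [hdwass]
          gcongr
          · linarith [(Nat.cast_nonneg n₀ : (0 : ℝ) ≤ n₀)]
          · exact hlower n hge hne
      _ = ENNReal.ofReal ((K / c + n₀ + 1) * n) * probSize p n := by
          rw [ENNReal.ofReal_mul (by positivity), ENNReal.ofReal_natCast, mul_assoc]
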